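/- arXiv:1702.01980 — 2 statements merged into one kernel-verified Lean document; each statement's English description precedes it below -/
import Mathlib

section
/- There exists a universal constant δ > 0 such that in the regime 0 < ε < 1/2 and λ_c ≤ λ < δ|log ε| the following holds: for every γ > 0 there exist positive constants c_γ, C_γ, C̃_γ (depending only on γ) such that every m ∈ H¹(𝕋²; S²) with F_{ε,λ}[m] ≤ −γ λ ε^{(λ_c − λ)/λ} / |log ε| satisfies the chain of inequalities ∫_{𝕋²} |∇m₃| dx ≤ ∫_{𝕋²} ( (ε/2)|∇m|² + (1−m₃²)/(2ε) ) dx ≤ (λ/|log ε|) ∫_{𝕋²} |∇^{1/2} m₃|² dx; moreover each of these three quantities A lies in [c_γ ε^{(λ_c−λ)/λ}, C_γ ε^{(λ_c−λ)/λ}], and any two of them, A and B, satisfy |A − B| ≤ C̃_γ (λ/|log ε|) A. -/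
open MeasureTheory Real Filter

noncomputable section

/-- The plane `ℝ²`, modeled as functions `Fin 2 → ℝ`. -/
abbrev R2 : Type := Fin 2 → ℝ

/-- The target space `ℝ³`. -/
abbrev R3 : Type := Fin 3 → ℝ

/-- A fundamental domain for the unit torus `𝕋² = ℝ²/ℤ²`. -/
def cube : Set R2 := Set.univ.pi fun _ => Set.Ico (0 : ℝ) 1

/-- The Euclidean norm on `ℝ²`. -/
def en2 (z : R2) : ℝ := Real.sqrt (∑ i, z i ^ 2)

/-- The Euclidean norm on `ℝ³`. -/
def en3 (v : R3) : ℝ := Real.sqrt (∑ i, v i ^ 2)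

/-- `|∇f(x)|²` for a scalar function. -/
def gradNormSq (f : R2 → ℝ) (x : R2) : ℝ :=
  ∑ j, (fderiv ℝ f x (Pi.single j 1)) ^ 2

/-- `|∇f(x)|` for a scalar function. -/
def gradNorm (f : R2 → ℝ) (x : R2) : ℝ := Real.sqrt (gradNormSq f x)

/-- `|∇m(x)|²` for a map `m : ℝ² → ℝ³` (Frobenius norm squared). -/
def gradVSq (m : R2 → R3) (x : R2) : ℝ :=
  ∑ j, ∑ i, (fderiv ℝ m x (Pi.single j 1) i) ^ 2

/-- The squared homogeneous `H^{1/2}` seminorm on the torus (real-space formula). -/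
def H12 (f : R2 → ℝ) : ℝ :=
  (1 / (4 * π)) * ∫ x in cube, ∫ z : R2, (f (x + z) - f x) ^ 2 / en2 z ^ 3

/-- A (strong) magnetization in `H¹(𝕋²; S²)`: a continuously differentiable
`ℤ²`-periodic map with values in the unit sphere `S² ⊂ ℝ³`. -/
def Mag (m : R2 → R3) : Prop :=
  ContDiff ℝ 1 m ∧
    (∀ (x : R2) (n : Fin 2 → ℤ), m (x + fun i => (n i : ℝ)) = m x) ∧
    ∀ x, ∑ i, (m x i) ^ 2 = 1

/-- The reduced thin-film energy `F_{ε,λ}`. -/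
def Fen (ε lam : ℝ) (m : R2 → R3) : ℝ :=
  (∫ x in cube, (ε / 2 * gradVSq m x + (1 - (m x 2) ^ 2) / (2 * ε)))
    - lam / |Real.log ε| * H12 (fun x => m x 2)

/-- The north pole `e₃ = (0,0,1)`. -/
def e3 : R3 := ![0, 0, 1]

lemma polar_sep (F : R2 → ENNReal) (S : Set ℝ) (hS : MeasurableSet S)
    (g h : ℝ → ENNReal) (hg : Measurable g) (hh : Measurable h)
    (hle : ∀ r θ : ℝ, 0 < r → r ∈ S →
      ENNReal.ofReal r * F ![r * cos θ, r * sin θ] ≤ g r * h θ) :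
    ∫⁻ z in en2 ⁻¹' S, F z ≤
      (∫⁻ r in S ∩ Set.Ioi 0, g r) * (∫⁻ θ in Set.Ioo (-π) π, h θ) := by
  have hen : Measurable en2 := by unfold en2; fun_prop
  have hSm : MeasurableSet (en2 ⁻¹' S) := hen hS
  rw [← lintegral_indicator hSm]
  have e1 := (volume_preserving_finTwoArrow ℝ).symm.lintegral_comp_emb
    (MeasurableEquiv.finTwoArrow (α := ℝ)).symm.measurableEmbedding ((en2 ⁻¹' S).indicator F)
  rw [← e1, ← lintegral_comp_polarCoord_symm]
  have e2 : polarCoord.target = Set.Ioi (0:ℝ) ×ˢ Set.Ioo (-π) π := rfl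
  rw [e2]
  have : ∀ p ∈ Set.Ioi (0:ℝ) ×ˢ Set.Ioo (-π) π,
      ENNReal.ofReal p.1 • (en2 ⁻¹' S).indicator F
        (MeasurableEquiv.finTwoArrow.symm (polarCoord.symm p)) ≤
      S.indicator g p.1 * h p.2 := by
    rintro ⟨r, θ⟩ ⟨hr, hθ⟩
    have hr : 0 < r := hr
    have e3 : (MeasurableEquiv.finTwoArrow (α := ℝ)).symm (polarCoord.symm (r, θ)) =
        ![r * cos θ, r * sin θ] := by
      simp [MeasurableEquiv.finTwoArrow, polarCoord_symm_apply]
    have e4 : en2 ![r * cos θ, r * sin θ] = r := by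
      unfold en2
      rw [Fin.sum_univ_two]
      simp only [Matrix.cons_val_zero, Matrix.cons_val_one]
      rw [show (r * cos θ)^2 + (r * sin θ)^2 = r^2 by
        have := Real.sin_sq_add_cos_sq θ
        linear_combination r^2 * this]
      exact Real.sqrt_sq hr.le
    rw [e3, smul_eq_mul]
    by_cases hrS : r ∈ S
    · rw [Set.indicator_of_mem (by simpa [e4] using hrS), Set.indicator_of_mem hrS]
      exact hle r θ hr hrS
    · rw [Set.indicator_of_notMem (by simpa [e4] using hrS)]
      simp
  refine (setLIntegral_mono (by
    refine Measurable.mul ((hg.indicator hS).comp measurable_fst) (hh.comp measurable_snd)) this).trans ?_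
  rw [Measure.volume_eq_prod, ← Measure.prod_restrict]
  rw [lintegral_prod_mul (hg.indicator hS).aemeasurable hh.aemeasurable]
  rw [lintegral_indicator hS, Measure.restrict_restrict hS]

lemma int_abs_trig (a b : ℝ) :
    ∫⁻ θ in Set.Ioo (-π) π, ENNReal.ofReal |a * cos θ + b * sin θ| =
      ENNReal.ofReal (4 * Real.sqrt (a ^ 2 + b ^ 2)) := by
  have hc : Continuous fun θ : ℝ => |a * cos θ + b * sin θ| := by fun_prop
  rw [← ofReal_integral_eq_lintegral_ofReal]
  rotate_left
  · exact (hc.integrableOn_Icc (a := -π) (b := π)).mono_set Set.Ioo_subset_Icc_self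
  · exact Eventually.of_forall fun _ => abs_nonneg _
  congr 1
  rw [← integral_Ioc_eq_integral_Ioo, ← intervalIntegral.integral_of_le (by linarith [pi_pos])]
  set z : ℂ := ⟨a, b⟩ with hz
  have hn : Real.sqrt (a^2 + b^2) = ‖z‖ := by
    rw [Complex.norm_def, Complex.normSq_apply]; simp [hz, sq]
  have ha : a = ‖z‖ * cos z.arg := by rw [Complex.norm_mul_cos_arg]
  have hb : b = ‖z‖ * sin z.arg := by rw [Complex.norm_mul_sin_arg]
  rw [hn]
  have e : ∀ θ : ℝ, |a * cos θ + b * sin θ| = ‖z‖ * |cos (θ - z.arg)| := by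
    intro θ
    nth_rewrite 1 [cos_sub, ← abs_of_nonneg (norm_nonneg z)]
    rw [← abs_mul]
    congr 1
    linear_combination cos θ * ha + sin θ * hb
  simp_rw [e]
  rw [intervalIntegral.integral_const_mul,
    intervalIntegral.integral_comp_sub_right (fun x => |cos x|)]
  have hper : Function.Periodic (fun x : ℝ => |cos x|) (2 * π) := fun x => by simp
  have h1 := hper.intervalIntegral_add_eq (-π - z.arg) (-(π / 2))
  rw [show -π - z.arg + 2 * π = π - z.arg by ring] at h1
  rw [h1]
  have hci : ∀ u v : ℝ, IntervalIntegrable (fun x : ℝ => |cos x|) volume u v := fun u v =>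
    Continuous.intervalIntegrable (by fun_prop) _ _
  rw [← intervalIntegral.integral_add_adjacent_intervals (hci _ (π/2)) (hci _ _)]
  have i1 : ∫ x in (-(π/2))..(π/2), |cos x| = 2 := by
    rw [intervalIntegral.integral_congr (g := cos)]
    · rw [integral_cos]; simp; norm_num
    · intro x hx
      rw [Set.uIcc_of_le (by linarith [pi_pos])] at hx
      exact abs_of_nonneg (cos_nonneg_of_mem_Icc hx)
  have i2 : ∫ x in (π/2)..(-(π/2) + 2 * π), |cos x| = 2 := by
    rw [intervalIntegral.integral_congr (g := fun x => - cos x)]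
    · rw [intervalIntegral.integral_neg, integral_cos]
      rw [show sin (-(π/2) + 2 * π) = -1 by simp]; simp; norm_num
    · intro x hx
      rw [Set.uIcc_of_le (by linarith [pi_pos])] at hx
      exact abs_of_nonpos (cos_nonpos_of_pi_div_two_le_of_le hx.1 (by linarith [hx.2]))
  rw [i1, i2]; ring

lemma en2_meas : Measurable en2 := by unfold en2; fun_prop
lemma en2_nonneg (z : R2) : 0 ≤ en2 z := Real.sqrt_nonneg _
lemma en2_polar (r θ : ℝ) (hr : 0 < r) : en2 ![r * cos θ, r * sin θ] = r := by
  unfold en2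
  rw [Fin.sum_univ_two]
  simp only [Matrix.cons_val_zero, Matrix.cons_val_one]
  rw [show (r * cos θ)^2 + (r * sin θ)^2 = r^2 by
    have := Real.sin_sq_add_cos_sq θ
    linear_combination r^2 * this]
  exact Real.sqrt_sq hr.le

lemma angle_vol : ∫⁻ _θ in Set.Ioo (-π) π, (1 : ENNReal) = ENNReal.ofReal (2 * π) := by
  rw [setLIntegral_one, Real.volume_Ioo]; congr 1; ring

lemma near_int (r0 : ℝ) :
    ∫⁻ z in en2 ⁻¹' Set.Iio r0, ENNReal.ofReal (en2 z ^ 2 / en2 z ^ 3) ≤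
      ENNReal.ofReal (2 * π * r0) := by
  refine (polar_sep _ _ measurableSet_Iio (fun _ => 1) (fun _ => 1) measurable_const
    measurable_const ?_).trans ?_
  · intro r θ hr _
    rw [en2_polar r θ hr, ← ENNReal.ofReal_mul hr.le]
    rw [show r * (r^2/r^3) = 1 by field_simp]; simp
  · rw [angle_vol, setLIntegral_one, Set.inter_comm, Set.Ioi_inter_Iio, Real.volume_Ioo, mul_comm,
      ← ENNReal.ofReal_mul (by positivity), sub_zero]

lemma far_int (R : ℝ) (h0 : 0 < R) :
    ∫⁻ z in en2 ⁻¹' Set.Ioi R, ENNReal.ofReal (4 / en2 z ^ 3) ≤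
      ENNReal.ofReal (8 * π / R) := by
  refine (polar_sep _ _ measurableSet_Ioi (fun r => ENNReal.ofReal (4 * r ^ (-2:ℝ)))
    (fun _ => 1) (by fun_prop) measurable_const ?_).trans ?_
  · intro r θ hr _
    rw [en2_polar r θ hr, ← ENNReal.ofReal_mul hr.le, mul_one]
    refine ENNReal.ofReal_le_ofReal (le_of_eq ?_)
    rw [Real.rpow_neg hr.le, Real.rpow_two]; field_simp
  · rw [angle_vol, Set.inter_eq_left.2 (Set.Ioi_subset_Ioi h0.le),
      ← ofReal_integral_eq_lintegral_ofReal]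
    · rw [integral_const_mul, integral_Ioi_rpow_of_lt (by norm_num) h0, mul_comm,
        ← ENNReal.ofReal_mul (by positivity)]
      refine ENNReal.ofReal_le_ofReal (le_of_eq ?_)
      rw [show (-2:ℝ)+1 = -1 by norm_num, Real.rpow_neg_one]; field_simp; norm_num
    · exact (integrableOn_Ioi_rpow_of_lt (by norm_num) h0).const_mul 4
    · refine (ae_restrict_iff' measurableSet_Ioi).2 (Eventually.of_forall fun x hx => ?_)
      have : 0 < x := h0.trans hx
      positivity

lemma ring_int (r0 R : ℝ) (h0 : 0 < r0) (hR : r0 ≤ R) (a : R2) :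
    ∫⁻ z in en2 ⁻¹' Set.Icc r0 R, ENNReal.ofReal (|∑ j, a j * z j| / en2 z ^ 3) ≤
      ENNReal.ofReal (4 * log (R / r0) * en2 a) := by
  refine (polar_sep _ _ measurableSet_Icc (fun r => ENNReal.ofReal (1 / r))
    (fun θ => ENNReal.ofReal |a 0 * cos θ + a 1 * sin θ|) (by fun_prop) (by fun_prop) ?_).trans ?_
  · intro r θ hr _
    rw [en2_polar r θ hr, ← ENNReal.ofReal_mul hr.le, ← ENNReal.ofReal_mul (by positivity)]
    refine ENNReal.ofReal_le_ofReal (le_of_eq ?_)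
    rw [Fin.sum_univ_two]
    simp only [Matrix.cons_val_zero, Matrix.cons_val_one]
    rw [show a 0 * (r * cos θ) + a 1 * (r * sin θ) = r * (a 0 * cos θ + a 1 * sin θ) by ring,
      abs_mul, abs_of_pos hr]
    field_simp
  · rw [int_abs_trig, Set.inter_eq_left.2 (show Set.Icc r0 R ⊆ Set.Ioi 0 from fun x hx => h0.trans_le hx.1),
      ← ofReal_integral_eq_lintegral_ofReal]
    · rw [integral_Icc_eq_integral_Ioc, ← intervalIntegral.integral_of_le hR,
        integral_one_div_of_pos h0 (h0.trans_le hR), ← ENNReal.ofReal_mul]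
      · refine ENNReal.ofReal_le_ofReal (le_of_eq ?_)
        rw [en2, Fin.sum_univ_two]; ring
      · exact log_nonneg ((one_le_div h0).2 hR)
    · refine ContinuousOn.integrableOn_Icc (ContinuousOn.div₀ continuousOn_const continuousOn_id
        (fun x hx => (h0.trans_le hx.1).ne'))
    · refine (ae_restrict_iff' measurableSet_Icc).2 (Eventually.of_forall fun x hx => ?_)
      have : 0 < x := h0.trans_le hx.1
      positivity

lemma transl (h : R2 → ENNReal) (hp : ∀ (x : R2) (n : Fin 2 → ℤ), h (x + fun i => (n i : ℝ)) = h x)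
    (w : R2) : ∫⁻ x in cube, h (x + w) = ∫⁻ x in cube, h x := by
  have hc : cube = ZSpan.fundamentalDomain (Pi.basisFun ℝ (Fin 2)) := by
    rw [ZSpan.fundamentalDomain_pi_basisFun]; rfl
  have hfd := ZSpan.isAddFundamentalDomain' (Pi.basisFun ℝ (Fin 2)) volume
  rw [← hc] at hfd
  have : Countable (Submodule.span ℤ (Set.range (Pi.basisFun ℝ (Fin 2)))).toAddSubgroup :=
    inferInstanceAs (Countable (Submodule.span ℤ (Set.range (Pi.basisFun ℝ (Fin 2)))))
  have hfd2 := hfd.vadd_of_comm w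
  have hinv : ∀ (g : (Submodule.span ℤ (Set.range (Pi.basisFun ℝ (Fin 2)))).toAddSubgroup) (x : R2),
      h (g +ᵥ x) = h x := by
    rintro ⟨g, hg⟩ x
    have hg : g ∈ Submodule.span ℤ (Set.range (Pi.basisFun ℝ (Fin 2))) := hg
    rw [Module.Basis.mem_span_iff_repr_mem] at hg
    choose n hn using hg
    have : g = fun i => (n i : ℝ) := by
      funext i
      have := hn i
      simpa using this.symm
    show h (g + x) = h x
    rw [add_comm, this, hp]
  rw [hfd.setLIntegral_eq hfd2 h hinv]
  have e := (measurePreserving_add_left (volume : Measure R2) w).setLIntegral_comp_emb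
    (measurableEmbedding_addLeft w) h cube
  simp_rw [add_comm _ w]
  exact e

lemma D_gen (f : R2 → ℝ) (hf : ContDiff ℝ 1 f)
    (hp : ∀ (x : R2) (n : Fin 2 → ℤ), f (x + fun i => (n i : ℝ)) = f x) (z : R2)
    (Ψ : ℝ → ℝ) (hΨ : Continuous Ψ)
    (hJ : ∀ u : ℝ → ℝ, Continuous u →
      ENNReal.ofReal (Ψ (∫ t in (0:ℝ)..1, u t)) ≤ ∫⁻ t in Set.Ioc (0:ℝ) 1, ENNReal.ofReal (Ψ (u t))) :
    ∫⁻ x in cube, ENNReal.ofReal (Ψ (f (x + z) - f x)) ≤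
      ∫⁻ x in cube, ENNReal.ofReal (Ψ (fderiv ℝ f x z)) := by
  have hdc : Continuous (fderiv ℝ f) := hf.continuous_fderiv (by norm_num)
  have hpd : ∀ (x : R2) (n : Fin 2 → ℤ), fderiv ℝ f (x + fun i => (n i : ℝ)) = fderiv ℝ f x := by
    intro x n
    rw [← fderiv_comp_add_right]
    simp_rw [hp]
  have hpt : ∀ x, ENNReal.ofReal (Ψ (f (x + z) - f x)) ≤
      ∫⁻ t in Set.Ioc (0:ℝ) 1, ENNReal.ofReal (Ψ (fderiv ℝ f (x + t • z) z)) := by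
    intro x
    have hc : Continuous fun t : ℝ => fderiv ℝ f (x + t • z) z := by fun_prop
    have hd : ∀ t : ℝ, HasDerivAt (fun t : ℝ => f (x + t • z)) (fderiv ℝ f (x + t • z) z) t := by
      intro t
      have h1 : HasDerivAt (fun t : ℝ => x + t • z) z t := by
        simpa using ((hasDerivAt_id t).smul_const z).const_add x
      exact ((hf.differentiable (by norm_num)) (x + t • z)).hasFDerivAt.comp_hasDerivAt t h1
    have := intervalIntegral.integral_eq_sub_of_hasDerivAt (a := 0) (b := 1) (fun t _ => hd t)
      (hc.intervalIntegrable _ _)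
    simp only [one_smul, zero_smul, add_zero] at this
    rw [← this]
    exact hJ _ hc
  refine (lintegral_mono hpt).trans ?_
  rw [lintegral_lintegral_swap]
  · have : ∀ t : ℝ, ∫⁻ x in cube, ENNReal.ofReal (Ψ (fderiv ℝ f (x + t • z) z)) =
        ∫⁻ x in cube, ENNReal.ofReal (Ψ (fderiv ℝ f x z)) := by
      intro t
      exact transl (fun x => ENNReal.ofReal (Ψ (fderiv ℝ f x z)))
        (fun x n => by simp only [hpd]) (t • z)
    simp_rw [this]
    simp
  · refine Measurable.aemeasurable ?_
    refine ENNReal.measurable_ofReal.comp (Continuous.measurable ?_)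
    show Continuous fun p : R2 × ℝ => Ψ (fderiv ℝ f (p.1 + p.2 • z) z)
    fun_prop

lemma D_abs (f : R2 → ℝ) (hf : ContDiff ℝ 1 f)
    (hp : ∀ (x : R2) (n : Fin 2 → ℤ), f (x + fun i => (n i : ℝ)) = f x) (z : R2) :
    ∫⁻ x in cube, ENNReal.ofReal |f (x + z) - f x| ≤
      ∫⁻ x in cube, ENNReal.ofReal |fderiv ℝ f x z| := by
  refine D_gen f hf hp z (fun s => |s|) continuous_abs ?_
  intro u hu
  rw [intervalIntegral.integral_of_le zero_le_one]
  simp_rw [← Real.enorm_eq_ofReal_abs]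
  exact enorm_integral_le_lintegral_enorm _

lemma D_sq (f : R2 → ℝ) (hf : ContDiff ℝ 1 f)
    (hp : ∀ (x : R2) (n : Fin 2 → ℤ), f (x + fun i => (n i : ℝ)) = f x) (z : R2) :
    ∫⁻ x in cube, ENNReal.ofReal ((f (x + z) - f x) ^ 2) ≤
      ∫⁻ x in cube, ENNReal.ofReal ((fderiv ℝ f x z) ^ 2) := by
  refine D_gen f hf hp z (fun s => s ^ 2) (by fun_prop) ?_
  intro u hu
  have hi : IntegrableOn (fun t => u t ^ 2) (Set.Ioc 0 1) :=
    (Continuous.integrableOn_Icc (a := (0:ℝ)) (b := 1) (by fun_prop)).mono_set Set.Ioc_subset_Icc_self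
  rw [← ofReal_integral_eq_lintegral_ofReal hi (Eventually.of_forall fun _ => sq_nonneg _)]
  refine ENNReal.ofReal_le_ofReal ?_
  rw [← intervalIntegral.integral_of_le zero_le_one]
  set c := ∫ t in (0:ℝ)..1, u t with hc
  have h1 : ∫ t in (0:ℝ)..1, (2 * c * u t - c ^ 2) ≤ ∫ t in (0:ℝ)..1, u t ^ 2 := by
    refine intervalIntegral.integral_mono zero_le_one (Continuous.intervalIntegrable (by fun_prop) _ _)
      (Continuous.intervalIntegrable (by fun_prop) _ _) ?_
    intro t
    nlinarith [sq_nonneg (u t - c)]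
  rw [intervalIntegral.integral_sub (Continuous.intervalIntegrable (by fun_prop) _ _)
      (Continuous.intervalIntegrable (by fun_prop) _ _), intervalIntegral.integral_const_mul] at h1
  simp only [intervalIntegral.integral_const, ← hc] at h1
  simp at h1
  nlinarith [h1]

lemma cube_meas : MeasurableSet cube := by
  unfold cube
  exact MeasurableSet.univ_pi fun _ => measurableSet_Ico

lemma cube_vol : volume cube = 1 := by
  unfold cube
  rw [volume_pi_pi]; simp

lemma cube_int (g : R2 → ℝ) (hg : Continuous g) : IntegrableOn g cube := by
  refine (hg.integrableOn_Icc (a := 0) (b := 1)).mono_set ?_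
  intro x hx
  exact ⟨fun i => (hx i trivial).1, fun i => (hx i trivial).2.le⟩

lemma fderiv_coord (f : R2 → ℝ) (x z : R2) :
    fderiv ℝ f x z = ∑ j, (fderiv ℝ f x (Pi.single j 1)) * z j := by
  conv_lhs => rw [pi_eq_sum_univ' z]
  rw [map_sum]
  refine Finset.sum_congr rfl fun j _ => ?_
  rw [map_smul, smul_eq_mul, mul_comm]

lemma gradNorm_eq (f : R2 → ℝ) (x : R2) :
    gradNorm f x = en2 (fun j => fderiv ℝ f x (Pi.single j 1)) := rfl

lemma fderiv_sq_le (f : R2 → ℝ) (x z : R2) :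
    (fderiv ℝ f x z) ^ 2 ≤ en2 z ^ 2 * gradNormSq f x := by
  rw [fderiv_coord, en2, Real.sq_sqrt (Finset.sum_nonneg fun _ _ => sq_nonneg _), gradNormSq, mul_comm]
  exact Finset.sum_mul_sq_le_sq_mul_sq _ _ _

lemma grad_cont (f : R2 → ℝ) (hf : ContDiff ℝ 1 f) :
    Continuous (gradNormSq f) ∧ Continuous (gradNorm f) := by
  have hdc : Continuous (fderiv ℝ f) := hf.continuous_fderiv (by norm_num)
  have h1 : Continuous (gradNormSq f) := by unfold gradNormSq; fun_prop
  exact ⟨h1, by unfold gradNorm; fun_prop⟩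

lemma gradNormSq_nonneg (f : R2 → ℝ) (x : R2) : 0 ≤ gradNormSq f x :=
  Finset.sum_nonneg fun _ _ => sq_nonneg _

lemma H12_le (f : R2 → ℝ) (hf : ContDiff ℝ 1 f)
    (hp : ∀ (x : R2) (n : Fin 2 → ℤ), f (x + fun i => (n i : ℝ)) = f x)
    (hb : ∀ x, |f x| ≤ 1) (r0 R : ℝ) (h0 : 0 < r0) (hR : r0 ≤ R) :
    H12 f ≤ r0 / 2 * (∫ x in cube, gradNormSq f x) +
      2 / π * log (R / r0) * (∫ x in cube, gradNorm f x) + 2 / R := by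
  obtain ⟨hc2, hc1⟩ := grad_cont f hf
  have hR0 : 0 < R := h0.trans_le hR
  have hlog : 0 ≤ log (R / r0) := log_nonneg ((one_le_div h0).2 hR)
  have hfc : Continuous f := hf.continuous
  have hdc : Continuous (fderiv ℝ f) := hf.continuous_fderiv (by norm_num)
  set G := ∫ x in cube, gradNormSq f x with hG
  set V := ∫ x in cube, gradNorm f x with hV
  have hG0 : 0 ≤ G := integral_nonneg fun x => gradNormSq_nonneg f x
  have hV0 : 0 ≤ V := integral_nonneg fun x => Real.sqrt_nonneg _
  have hGl : ∫⁻ x in cube, ENNReal.ofReal (gradNormSq f x) = ENNReal.ofReal G :=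
    (ofReal_integral_eq_lintegral_ofReal (cube_int _ hc2)
      (Eventually.of_forall fun x => gradNormSq_nonneg f x)).symm
  have hVl : ∫⁻ x in cube, ENNReal.ofReal (gradNorm f x) = ENNReal.ofReal V :=
    (ofReal_integral_eq_lintegral_ofReal (cube_int _ hc1)
      (Eventually.of_forall fun x => Real.sqrt_nonneg _)).symm
  have hem := en2_meas
  set D : R2 → ENNReal := fun z =>
    ∫⁻ x in cube, ENNReal.ofReal ((f (x + z) - f x) ^ 2 / en2 z ^ 3) with hD
  have hDz : ∀ z, D z = ENNReal.ofReal (1 / en2 z ^ 3) *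
      ∫⁻ x in cube, ENNReal.ofReal ((f (x + z) - f x) ^ 2) := by
    intro z
    rw [← lintegral_const_mul _ (by fun_prop)]
    refine lintegral_congr fun x => ?_
    rw [← ENNReal.ofReal_mul (by have := en2_nonneg z; positivity)]
    congr 1; ring
  have hnear : ∫⁻ z in en2 ⁻¹' Set.Iio r0, D z ≤ ENNReal.ofReal (2 * π * r0 * G) := by
    have : ∀ z, D z ≤ ENNReal.ofReal (en2 z ^ 2 / en2 z ^ 3) * ENNReal.ofReal G := by
      intro z
      rw [hDz, ← hGl]
      refine (mul_le_mul_right (D_sq f hf hp z) _).trans ?_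
      rw [← lintegral_const_mul _ (by fun_prop), ← lintegral_const_mul _ (by fun_prop)]
      refine lintegral_mono fun x => ?_
      have hz := en2_nonneg z
      rw [← ENNReal.ofReal_mul (by positivity), ← ENNReal.ofReal_mul (by positivity)]
      refine ENNReal.ofReal_le_ofReal ?_
      calc 1 / en2 z ^ 3 * (fderiv ℝ f x z) ^ 2 ≤ 1 / en2 z ^ 3 * (en2 z ^ 2 * gradNormSq f x) :=
            mul_le_mul_of_nonneg_left (fderiv_sq_le f x z) (by positivity)
        _ = _ := by ring
    refine (lintegral_mono this).trans ?_
    rw [lintegral_mul_const _ (by fun_prop), ENNReal.ofReal_mul' hG0]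
    exact mul_le_mul_left (near_int r0) _
  have hring : ∫⁻ z in en2 ⁻¹' Set.Icc r0 R, D z ≤ ENNReal.ofReal (8 * log (R / r0) * V) := by
    have : ∀ z, D z ≤ ∫⁻ x in cube, 2 * ENNReal.ofReal
        (|∑ j, (fderiv ℝ f x (Pi.single j 1)) * z j| / en2 z ^ 3) := by
      intro z
      have hz := en2_nonneg z
      have h1 : ∫⁻ x in cube, ENNReal.ofReal ((f (x + z) - f x) ^ 2) ≤
          2 * ∫⁻ x in cube, ENNReal.ofReal |fderiv ℝ f x z| := by
        refine le_trans ?_ (mul_le_mul_right (D_abs f hf hp z) 2)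
        rw [← lintegral_const_mul _ (by fun_prop)]
        refine lintegral_mono fun x => ?_
        rw [show (2:ENNReal) = ENNReal.ofReal 2 by simp, ← ENNReal.ofReal_mul (by norm_num)]
        refine ENNReal.ofReal_le_ofReal ?_
        have h2 : |f (x + z) - f x| ≤ 2 :=
          (abs_sub _ _).trans (by linarith [hb (x + z), hb x])
        rw [← sq_abs, sq]
        exact mul_le_mul_of_nonneg_right h2 (abs_nonneg _)
      rw [hDz]
      refine (mul_le_mul_right h1 _).trans ?_
      rw [← lintegral_const_mul _ (by fun_prop), ← lintegral_const_mul _ (by fun_prop)]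
      refine lintegral_mono fun x => ?_
      rw [← fderiv_coord, mul_left_comm, ← ENNReal.ofReal_mul (by positivity)]
      refine le_of_eq ?_
      congr 2; ring
    refine (lintegral_mono this).trans ?_
    rw [lintegral_lintegral_swap]
    · refine (lintegral_mono (g := fun x => 2 * ENNReal.ofReal (4 * log (R / r0)) *
        ENNReal.ofReal (gradNorm f x)) fun x => ?_).trans ?_
      · rw [lintegral_const_mul _ (by fun_prop)]
        beta_reduce
        rw [mul_assoc]
        refine mul_le_mul_right ?_ _
        rw [← ENNReal.ofReal_mul (by positivity), gradNorm_eq]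
        exact ring_int r0 R h0 hR _
      · rw [lintegral_const_mul _ (by fun_prop), hVl, show (2:ENNReal) = ENNReal.ofReal 2 by simp,
          ← ENNReal.ofReal_mul (by norm_num), ← ENNReal.ofReal_mul (by positivity)]
        refine ENNReal.ofReal_le_ofReal (le_of_eq ?_)
        ring
    · refine Measurable.aemeasurable ?_
      refine Measurable.const_mul (ENNReal.measurable_ofReal.comp ?_) _
      refine Measurable.div (Continuous.measurable ?_) ?_
      · show Continuous fun p : R2 × R2 => |∑ j, (fderiv ℝ f p.2 (Pi.single j 1)) * p.1 j|
        fun_prop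
      · show Measurable fun p : R2 × R2 => en2 p.1 ^ 3
        fun_prop
  have hfar : ∫⁻ z in en2 ⁻¹' Set.Ioi R, D z ≤ ENNReal.ofReal (8 * π / R) := by
    refine le_trans (lintegral_mono fun z => ?_) (far_int R hR0)
    have hz := en2_nonneg z
    calc D z ≤ ∫⁻ x in cube, ENNReal.ofReal (4 / en2 z ^ 3) := by
          refine lintegral_mono fun x => ENNReal.ofReal_le_ofReal ?_
          refine div_le_div_of_nonneg_right ?_ (by positivity)
          have h2 : |f (x + z) - f x| ≤ 2 :=
            (abs_sub _ _).trans (by linarith [hb (x + z), hb x])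
          rw [← sq_abs]
          nlinarith [abs_nonneg (f (x + z) - f x)]
      _ = _ := by rw [setLIntegral_const, cube_vol, mul_one]
  have hall : ∫⁻ z, D z ≤ ENNReal.ofReal (2 * π * r0 * G + 8 * log (R / r0) * V + 8 * π / R) := by
    have hu : (Set.univ : Set R2) =
        (en2 ⁻¹' Set.Iio r0 ∪ en2 ⁻¹' Set.Icc r0 R) ∪ en2 ⁻¹' Set.Ioi R := by
      ext z
      simp only [Set.mem_univ, Set.mem_union, Set.mem_preimage, Set.mem_Iio, Set.mem_Icc,
        Set.mem_Ioi, true_iff]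
      by_cases h : en2 z < r0
      · simp [h]
      · by_cases h' : R < en2 z
        · simp [h']
        · left; right; exact ⟨not_lt.1 h, not_lt.1 h'⟩
    rw [← setLIntegral_univ, hu, ENNReal.ofReal_add (by positivity) (by positivity),
      ENNReal.ofReal_add (by positivity) (by positivity)]
    refine (lintegral_union_le _ _ _).trans (add_le_add ?_ hfar)
    exact (lintegral_union_le _ _ _).trans (add_le_add hnear hring)
  have hI : ‖∫ x in cube, ∫ z : R2, (f (x + z) - f x) ^ 2 / en2 z ^ 3‖ₑ ≤ ∫⁻ z, D z := by
    refine (enorm_integral_le_lintegral_enorm _).trans ?_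
    refine (lintegral_mono fun x => enorm_integral_le_lintegral_enorm _).trans ?_
    rw [lintegral_lintegral_swap]
    · refine le_of_eq (lintegral_congr fun z => lintegral_congr fun x => ?_)
      have hz := en2_nonneg z
      rw [Real.enorm_eq_ofReal (by positivity)]
    · refine Measurable.aemeasurable (Measurable.enorm ?_)
      show Measurable fun p : R2 × R2 => (f (p.1 + p.2) - f p.1) ^ 2 / en2 p.2 ^ 3
      have := hfc.measurable
      fun_prop
  have hI2 := hI.trans hall
  rw [Real.enorm_eq_ofReal_abs, ENNReal.ofReal_le_ofReal_iff (by positivity)] at hI2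
  unfold H12
  have hpi := pi_pos
  calc _ ≤ 1 / (4 * π) * (2 * π * r0 * G + 8 * log (R / r0) * V + 8 * π / R) :=
        mul_le_mul_of_nonneg_left ((le_abs_self _).trans hI2) (by positivity)
    _ = _ := by field_simp; ring

lemma key (m : R2 → R3) (hm : Mag m) (ε : ℝ) (hε : 0 < ε) :
    (∫ x in cube, gradNorm (fun y => m y 2) x) ≤
      (∫ x in cube, (ε / 2 * gradVSq m x + (1 - (m x 2) ^ 2) / (2 * ε))) ∧
    0 ≤ (∫ x in cube, gradNorm (fun y => m y 2) x) ∧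
    ∀ R, ε ≤ R → H12 (fun y => m y 2) ≤
      (∫ x in cube, (ε / 2 * gradVSq m x + (1 - (m x 2) ^ 2) / (2 * ε))) +
      2 / π * log (R / ε) * (∫ x in cube, gradNorm (fun y => m y 2) x) + 2 / R := by
  obtain ⟨hc, hp, h1⟩ := hm
  have hdiff : Differentiable ℝ m := hc.differentiable (by norm_num)
  have hmc : Continuous m := hc.continuous
  have hdc : Continuous (fderiv ℝ m) := hc.continuous_fderiv (by norm_num)
  have hf : ContDiff ℝ 1 (fun y => m y 2) := (contDiff_pi.1 hc) 2
  obtain ⟨hc2, hc1⟩ := grad_cont _ hf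
  have hcomp : ∀ (i : Fin 3) x v, fderiv ℝ (fun y => m y i) x v = fderiv ℝ m x v i := by
    intro i x v
    rw [fderiv_apply (hdiff x)]; rfl
  have hgs : ∀ x, gradNormSq (fun y => m y 2) x = ∑ j, (fderiv ℝ m x (Pi.single j 1) 2) ^ 2 := by
    intro x; unfold gradNormSq; simp_rw [hcomp]
  have hor : ∀ x v, ∑ i, m x i * fderiv ℝ m x v i = 0 := by
    intro x v
    have hi : ∀ i, HasFDerivAt (fun y => m y i) (fderiv ℝ (fun y => m y i) x) x := fun i =>
      ((differentiableAt_pi.1 (hdiff x)) i).hasFDerivAt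
    have hd : HasFDerivAt (fun y => ∑ i, m y i * m y i)
        (∑ i, (m x i • fderiv ℝ (fun y => m y i) x + m x i • fderiv ℝ (fun y => m y i) x)) x :=
      HasFDerivAt.fun_sum fun i _ => (hi i).mul (hi i)
    have hcst : (fun y => ∑ i, m y i * m y i) = fun _ => (1:ℝ) := by
      funext y; rw [← h1 y]; simp_rw [sq]
    rw [hcst] at hd
    have := congrArg (fun T => T v) (hd.unique (hasFDerivAt_const (1:ℝ) x))
    simp only [add_apply,
      smul_apply, hcomp, smul_eq_mul, zero_apply,
      Fin.sum_univ_three] at this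
    rw [Fin.sum_univ_three]
    linarith
  have hB0 : ∀ x, 0 ≤ 1 - (m x 2) ^ 2 := by
    intro x
    have := h1 x
    rw [Fin.sum_univ_three] at this
    nlinarith [sq_nonneg (m x 0), sq_nonneg (m x 1)]
  have hA0 : ∀ x, 0 ≤ gradVSq m x := fun x =>
    Finset.sum_nonneg fun _ _ => Finset.sum_nonneg fun _ _ => sq_nonneg _
  have hb1 : ∀ x, gradNormSq (fun y => m y 2) x ≤ gradVSq m x := by
    intro x
    rw [hgs]; unfold gradVSq
    refine Finset.sum_le_sum fun j _ => ?_
    rw [Fin.sum_univ_three]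
    nlinarith [sq_nonneg (fderiv ℝ m x (Pi.single j 1) 0), sq_nonneg (fderiv ℝ m x (Pi.single j 1) 1)]
  have hb2 : ∀ x, gradNormSq (fun y => m y 2) x ≤ (1 - (m x 2) ^ 2) * gradVSq m x := by
    intro x
    rw [hgs]; unfold gradVSq
    rw [Finset.mul_sum]
    refine Finset.sum_le_sum fun j _ => ?_
    have ho := hor x (Pi.single j 1)
    have hn := h1 x
    rw [Fin.sum_univ_three] at ho hn ⊢
    generalize fderiv ℝ m x (Pi.single j 1) 0 = d0 at *
    generalize fderiv ℝ m x (Pi.single j 1) 1 = d1 at *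
    generalize fderiv ℝ m x (Pi.single j 1) 2 = d2 at *
    generalize m x 0 = a0 at *
    generalize m x 1 = a1 at *
    generalize m x 2 = a2 at *
    have e1 : 1 - a2 ^ 2 = a0 ^ 2 + a1 ^ 2 := by linarith
    have e2 : (a2 * d2) ^ 2 = (a0 * d0 + a1 * d1) ^ 2 := by
      rw [show a2 * d2 = -(a0 * d0 + a1 * d1) by linarith]; ring
    have e3 : d2 ^ 2 = (a2 * d2) ^ 2 + (a0 ^ 2 + a1 ^ 2) * d2 ^ 2 := by rw [← e1]; ring
    rw [e1, e3, e2]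
    nlinarith [sq_nonneg (a0 * d1 - a1 * d0)]
  have hEc : Continuous fun x => ε / 2 * gradVSq m x + (1 - (m x 2) ^ 2) / (2 * ε) := by
    unfold gradVSq; fun_prop
  refine ⟨?_, integral_nonneg fun x => Real.sqrt_nonneg _, ?_⟩
  · refine setIntegral_mono (cube_int _ hc1) (cube_int _ hEc) fun x => ?_
    have hA := hA0 x
    have hB := hB0 x
    refine Real.sqrt_le_iff.2 ⟨by positivity, (hb2 x).trans ?_⟩
    have e : (ε / 2 * gradVSq m x + (1 - (m x 2) ^ 2) / (2 * ε)) ^ 2 -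
        (1 - (m x 2) ^ 2) * gradVSq m x =
        (ε / 2 * gradVSq m x - (1 - (m x 2) ^ 2) / (2 * ε)) ^ 2 := by
      field_simp; ring
    nlinarith [sq_nonneg (ε / 2 * gradVSq m x - (1 - (m x 2) ^ 2) / (2 * ε))]
  · intro R hR
    have hb : ∀ x, |m x 2| ≤ 1 := fun x => by
      rw [← sq_le_one_iff_abs_le_one]; linarith [hB0 x]
    have hH := H12_le _ hf (fun x n => by rw [hp]) hb ε R hε hR
    have hG : ε / 2 * (∫ x in cube, gradNormSq (fun y => m y 2) x) ≤
        ∫ x in cube, (ε / 2 * gradVSq m x + (1 - (m x 2) ^ 2) / (2 * ε)) := by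
      rw [← integral_const_mul]
      refine setIntegral_mono (cube_int _ (by fun_prop)) (cube_int _ hEc) fun x => ?_
      have h2 : ε / 2 * gradNormSq (fun y => m y 2) x ≤ ε / 2 * gradVSq m x :=
        mul_le_mul_of_nonneg_left (hb1 x) (by positivity)
      have h3 : 0 ≤ (1 - (m x 2) ^ 2) / (2 * ε) := div_nonneg (hB0 x) (by positivity)
      show ε / 2 * gradNormSq (fun y => m y 2) x ≤ _
      linarith
    linarith

lemma scaled (ε lam E V H : ℝ) (hε : 0 < ε) (hε2 : ε < 1 / 2) (hl : π / 2 ≤ lam)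
    (hl2 : lam < 1 / 2 * |log ε|)
    (hk : ∀ R, ε ≤ R → H ≤ E + 2 / π * log (R / ε) * V + 2 / R) (ρ : ℝ) (hρ : exp (-π) ≤ ρ) :
    lam / |log ε| * H ≤ lam / |log ε| * E + V + lam / |log ε| * (2 / π * log ρ) * V
      + lam / |log ε| * (2 / ρ) * ε ^ ((π / 2 - lam) / lam) := by
  have hpi := pi_pos
  have hlam : 0 < lam := by linarith
  have hlog : log ε < 0 := log_neg hε (by linarith)
  have hρ0 : 0 < ρ := (exp_pos _).trans_le hρ
  have hlr : -π ≤ log ρ := (le_log_iff_exp_le hρ0).2 hρ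
  rw [abs_of_neg hlog] at *
  set S := ε ^ ((π / 2 - lam) / lam) with hS
  have hS0 : 0 < S := rpow_pos_of_pos hε _
  have hlS : log S = (π / 2 - lam) / lam * log ε := log_rpow hε _
  set L := - log ε with hL
  have hL0 : 0 < L := by linarith
  have hlS' : log S = L - L * π / (2 * lam) := by
    rw [hlS, show log ε = -L by simp [hL]]; field_simp; ring
  have hLl : 2 ≤ L / lam := by rw [le_div_iff₀ hlam]; linarith
  have hle : ε ≤ ρ / S := by
    rw [le_div_iff₀ hS0, ← log_le_log_iff (by positivity) hρ0, log_mul hε.ne' hS0.ne', hlS']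
    have : L * π / (2 * lam) = L / lam * π / 2 := by field_simp
    rw [this]
    nlinarith
  have h := hk _ hle
  have hlr2 : log (ρ / S / ε) = log ρ + L * π / (2 * lam) := by
    rw [log_div (by positivity) hε.ne', log_div hρ0.ne' hS0.ne', hlS']; linear_combination hL
  rw [hlr2] at h
  have hs : 0 < lam / L := by positivity
  calc lam / L * H ≤ lam / L * (E + 2 / π * (log ρ + L * π / (2 * lam)) * V + 2 / (ρ / S)) :=
        mul_le_mul_of_nonneg_left h hs.le
    _ = _ := by field_simp; ring

lemma arith (V E Q S s γ κ C c P : ℝ) (hγ : 0 < γ) (hκ0 : 0 ≤ κ) (hργ : P ≤ γ / 2)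
    (hC0 : 0 < C) (hc : c = γ / (2 * (1 + κ))) (hV0 : 0 ≤ V) (hVE : V ≤ E) (hS0 : 0 < S)
    (hs0 : 0 < s) (hs2 : s < 1 / 2) (hF : E - Q ≤ -γ * s * S)
    (K1 : Q ≤ s * E + V + s * (-2) * V + s * C * S)
    (K2 : Q ≤ s * E + V + s * κ * V + s * P * S) :
    E ≤ Q ∧ Q - V ≤ 3 * (C * (s * S)) ∧ Q ≤ 3 * C * S ∧ c * S ≤ V := by
  have hsS : 0 < s * S := mul_pos hs0 hS0
  have hgsS : 0 < γ * (s * S) := mul_pos hγ hsS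
  have hEQ : E ≤ Q := by nlinarith
  have hEV : (E - V) / 2 ≤ (E - V) * (1 - s) := by nlinarith
  have hsV : 0 ≤ s * V := mul_nonneg hs0.le hV0
  have hCsS : 0 < C * (s * S) := mul_pos hC0 hsS
  have hVC : V ≤ C * S := by
    have : s * V ≤ s * (C * S) := by nlinarith
    exact le_of_mul_le_mul_left this hs0
  have hEV2 : E - V ≤ 2 * (C * (s * S)) := by nlinarith
  have hQE : Q - E ≤ C * (s * S) := by nlinarith
  have hQV : Q - V ≤ 3 * (C * (s * S)) := by linarith
  have hQC : Q ≤ 3 * C * S := by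
    have h2 : C * (s * S) ≤ C * S / 2 := by nlinarith [mul_pos hC0 hS0]
    have h3 := mul_pos hC0 hS0
    linarith
  have hcV : c * S ≤ V := by
    have h1 : s * (P) * S ≤ γ / 2 * (s * S) := by nlinarith
    have h2 : (1 - s) * V ≤ (1 - s) * E := mul_le_mul_of_nonneg_left hVE (by linarith)
    have h3 : s * (γ / 2 * S) ≤ s * ((1 + κ) * V) := by nlinarith
    have h4 := le_of_mul_le_mul_left h3 hs0
    rw [hc, div_mul_eq_mul_div, div_le_iff₀ (by positivity)]
    linarith
  exact ⟨hEQ, hQV, hQC, hcV⟩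

/-- Theorem `th:SUPERcrit-F`, characterization of optimal profiles:
in the supercritical regime, maps achieving the optimal energy scaling satisfy a chain of
inequalities among the three energy quantities, each of which scales like
`ε^{(λ_c-λ)/λ}`, and any two of which agree to leading order. -/
theorem stmt_14 :
    ∃ δ : ℝ, 0 < δ ∧
      ∀ γ : ℝ, 0 < γ →
        ∃ cγ Cγ Ctγ : ℝ, 0 < cγ ∧ 0 < Cγ ∧ 0 < Ctγ ∧
          ∀ ε lam : ℝ, 0 < ε → ε < 1 / 2 → π / 2 ≤ lam → lam < δ * |Real.log ε| →
            ∀ m : R2 → R3, Mag m →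
              Fen ε lam m ≤ -γ * lam * ε ^ ((π / 2 - lam) / lam) / |Real.log ε| →
                (∫ x in cube, gradNorm (fun y => m y 2) x) ≤
                    (∫ x in cube, (ε / 2 * gradVSq m x + (1 - (m x 2) ^ 2) / (2 * ε))) ∧
                (∫ x in cube, (ε / 2 * gradVSq m x + (1 - (m x 2) ^ 2) / (2 * ε))) ≤
                    lam / |Real.log ε| * H12 (fun y => m y 2) ∧
                (∀ A ∈ ({(∫ x in cube, gradNorm (fun y => m y 2) x),
                          (∫ x in cube, (ε / 2 * gradVSq m x + (1 - (m x 2) ^ 2) / (2 * ε))),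
                          lam / |Real.log ε| * H12 (fun y => m y 2)} : Set ℝ),
                  (cγ * ε ^ ((π / 2 - lam) / lam) ≤ A ∧
                    A ≤ Cγ * ε ^ ((π / 2 - lam) / lam)) ∧
                  ∀ B ∈ ({(∫ x in cube, gradNorm (fun y => m y 2) x),
                          (∫ x in cube, (ε / 2 * gradVSq m x + (1 - (m x 2) ^ 2) / (2 * ε))),
                          lam / |Real.log ε| * H12 (fun y => m y 2)} : Set ℝ),
                    |A - B| ≤ Ctγ * (lam / |Real.log ε|) * A) := by
  refine ⟨1 / 2, by norm_num, fun γ hγ => ?_⟩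
  have hpi := pi_pos
  set ρ := max 1 (4 / γ) with hρ
  have hρ1 : 1 ≤ ρ := le_max_left _ _
  set κ := 2 / π * log ρ with hκ
  have hκ0 : 0 ≤ κ := mul_nonneg (by positivity) (log_nonneg hρ1)
  have hργ : 2 / ρ ≤ γ / 2 := by
    have h4 : 4 / γ ≤ ρ := le_max_right _ _
    rw [div_le_iff₀ hγ] at h4
    rw [div_le_iff₀ (by linarith)]; linarith
  set C := 2 * exp π with hC
  have hC0 : 0 < C := by positivity
  set c := γ / (2 * (1 + κ)) with hc
  have hc0 : 0 < c := by positivity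
  refine ⟨c, 3 * C, 3 * C / c, hc0, by positivity, by positivity, ?_⟩
  intro ε lam hε hε2 hl hl2 m hm hF
  obtain ⟨hVE, hV0, hk⟩ := key m hm ε hε
  have hlog : log ε < 0 := log_neg hε (by linarith)
  have hL0 : 0 < |log ε| := abs_pos.2 hlog.ne
  have K1 := scaled ε lam _ _ _ hε hε2 hl hl2 hk (exp (-π)) le_rfl
  have K2 := scaled ε lam _ _ _ hε hε2 hl hl2 hk ρ
    ((exp_le_one_iff.2 (by linarith)).trans hρ1)
  unfold Fen at hF
  set V := ∫ x in cube, gradNorm (fun y => m y 2) x with hV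
  set E := ∫ x in cube, (ε / 2 * gradVSq m x + (1 - (m x 2) ^ 2) / (2 * ε)) with hE
  set S := ε ^ ((π / 2 - lam) / lam) with hS
  have hS0 : 0 < S := rpow_pos_of_pos hε _
  have hs2 : lam / |log ε| < 1 / 2 := by rw [div_lt_iff₀ hL0]; exact hl2
  have hs0 : 0 < lam / |log ε| := div_pos (by linarith) hL0
  rw [show -γ * lam * S / |log ε| = -γ * (lam / |log ε|) * S by ring] at hF
  set s := lam / |log ε| with hs
  set Q := s * H12 (fun y => m y 2) with hQ
  rw [← hκ] at K2
  rw [log_exp, show 2 / exp (-π) = C by rw [exp_neg]; field_simp; exact hC.symm,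
    show 2 / π * -π = -2 by field_simp] at K1
  obtain ⟨hEQ, hQV, hQC, hcV⟩ := arith V E Q S s γ κ C c (2 / ρ) hγ hκ0 hργ hC0 hc hV0 hVE hS0
    hs0 hs2 hF K1 K2
  refine ⟨hVE, hEQ, ?_⟩
  have hrange : ∀ A ∈ ({V, E, Q} : Set ℝ), V ≤ A ∧ A ≤ Q := by
    rintro A (rfl | rfl | rfl)
    · exact ⟨le_rfl, hVE.trans hEQ⟩
    · exact ⟨hVE, hEQ⟩
    · exact ⟨hVE.trans hEQ, le_rfl⟩
  intro A hA
  obtain ⟨hA1, hA2⟩ := hrange A hA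
  refine ⟨⟨hcV.trans hA1, hA2.trans hQC⟩, fun B hB => ?_⟩
  obtain ⟨hB1, hB2⟩ := hrange B hB
  have h5 : |A - B| ≤ 3 * (C * (s * S)) := by rw [abs_le]; constructor <;> linarith
  refine h5.trans ?_
  have h6 : 3 * C / c * s * (c * S) ≤ 3 * C / c * s * A :=
    mul_le_mul_of_nonneg_left (hcV.trans hA1) (by positivity)
  refine le_trans (le_of_eq ?_) h6
  field_simp
end
end

section
/- There exist constants K ∈ (0,1) and c > 0 such that for every pair (ε, λ) with λ > λ_c and 0 < ε^{(λ − λ_c)/λ} < K, there exists m ∈ H¹(𝕋²; S²) with F_{ε,λ}[m] ≤ −c · λ ε^{(λ_c − λ)/λ} / |log ε|. -/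
open MeasureTheory Real Filter

noncomputable section

/-- hyperbolic tangent as a quotient. -/
def th (y : ℝ) : ℝ := Real.sinh y / Real.cosh y

lemma th_deriv (y : ℝ) : HasDerivAt th (1 / Real.cosh y ^ 2) y := by
  have h := (Real.hasDerivAt_sinh y).div (Real.hasDerivAt_cosh y) (Real.cosh_pos y).ne'
  refine h.congr_deriv ?_
  have := Real.cosh_sq y
  congr 1
  nlinarith

lemma th_contDiff : ContDiff ℝ 1 th :=
  Real.contDiff_sinh.div Real.contDiff_cosh (fun y => (Real.cosh_pos y).ne')

lemma th_cont : Continuous th := th_contDiff.continuous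

lemma th_neg (y : ℝ) : th (-y) = - th y := by
  simp [th, neg_div]

lemma th_le_one (y : ℝ) : th y ≤ 1 := by
  unfold th
  rw [div_le_one (Real.cosh_pos y)]
  exact (Real.sinh_lt_cosh y).le

lemma th_abs (y : ℝ) : |th y| ≤ 1 := by
  rw [abs_le]
  refine ⟨?_, th_le_one y⟩
  have := th_le_one (-y)
  rw [th_neg] at this
  linarith

lemma th_lower (y : ℝ) : 1 - 2 * Real.exp (-(2 * y)) ≤ th y := by
  unfold th
  rw [le_div_iff₀ (Real.cosh_pos y), Real.sinh_eq, Real.cosh_eq]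
  have h1 : Real.exp (-(2*y)) = Real.exp (-y) * Real.exp (-y) := by
    rw [← Real.exp_add]; ring_nf
  have h2 : Real.exp (-y) * Real.exp y = 1 := by
    rw [← Real.exp_add]; simp
  have h3 := Real.exp_pos (-y)
  rw [h1]
  set a := Real.exp (-y)
  set b := Real.exp y
  have : a * a * b = a := by rw [mul_assoc, h2, mul_one]
  nlinarith [mul_pos (mul_pos h3 h3) h3]

lemma th_sq (y : ℝ) : 1 - th y ^ 2 = 1 / Real.cosh y ^ 2 := by
  unfold th
  have := Real.cosh_sq y
  have h := (Real.cosh_pos y).ne'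
  field_simp
  linarith

lemma cosh_ge (y : ℝ) : 1 + y ^ 2 ≤ Real.cosh y ^ 2 := by
  rw [Real.cosh_sq]
  have : |y| ≤ |Real.sinh y| := by
    rw [Real.abs_sinh]
    exact Real.self_le_sinh_iff.2 (abs_nonneg y)
  have := sq_le_sq.2 this
  linarith

lemma th_lip (x y : ℝ) : |th x - th y| ≤ |x - y| := by
  have := Convex.norm_image_sub_le_of_norm_deriv_le (f := th) (C := 1) (s := Set.univ)
    (x := y) (y := x) (fun z _ => (th_deriv z).differentiableAt) (fun z _ => ?_) convex_univ trivial trivial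
  · simpa using this
  · rw [(th_deriv z).deriv, Real.norm_eq_abs, abs_of_nonneg (by positivity)]
    rw [div_le_one (by have := Real.cosh_pos z; positivity)]
    nlinarith [cosh_ge z]

/-- the basic periodic profile -/
def gg (A t : ℝ) : ℝ := th (A * Real.sin t)

lemma gg_cont (A : ℝ) : Continuous (gg A) := by
  unfold gg
  exact th_cont.comp (by fun_prop)

lemma gg_neg (A t : ℝ) : gg A (-t) = - gg A t := by
  simp [gg, th_neg]

lemma gg_pi (A t : ℝ) : gg A (t + π) = - gg A t := by
  simp [gg, th_neg]

lemma gg_lip (A : ℝ) (hA : 0 < A) (x y : ℝ) : |gg A x - gg A y| ≤ A * |x - y| := by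
  refine (th_lip _ _).trans ?_
  rw [← mul_sub, abs_mul, abs_of_pos hA]
  have h := Real.lipschitzWith_sin.dist_le_mul x y
  simp only [Real.dist_eq, NNReal.coe_one, one_mul] at h
  exact mul_le_mul_of_nonneg_left h hA.le

lemma gg_lower (A : ℝ) (hA : 0 < A) (s : ℝ) (h0 : 0 ≤ s) (h1 : s ≤ π / 2) :
    1 - 2 * Real.exp (-(4 * A / π * s)) ≤ gg A s := by
  refine le_trans ?_ (th_lower _)
  have := Real.mul_le_sin h0 h1
  have h3 : 4 * A / π * s ≤ 2 * (A * Real.sin s) := by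
    calc 4 * A / π * s = 2 * (A * (2 / π * s)) := by ring
      _ ≤ _ := by gcongr
  gcongr

lemma gg_nonneg (A : ℝ) (hA : 0 < A) (s : ℝ) (h0 : 0 ≤ s) (h1 : s ≤ π / 2) : 0 ≤ gg A s := by
  unfold gg th
  have h2 : 0 ≤ Real.sin s := Real.sin_nonneg_of_nonneg_of_le_pi h0 (by linarith [Real.pi_pos])
  exact div_nonneg (Real.sinh_nonneg_iff.2 (by positivity)) (Real.cosh_pos _).le

/-- integrand -/
def JJi (A t s : ℝ) : ℝ := (gg A (t + s) - gg A t) ^ 2 / s ^ 2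

def JJ (A t : ℝ) : ℝ := ∫ s, JJi A t s

lemma JJi_nonneg (A t s : ℝ) : 0 ≤ JJi A t s := by unfold JJi; positivity

lemma JJi_le (A : ℝ) (hA : 0 < A) (t s : ℝ) : JJi A t s ≤ (A ^ 2 + 4) * (1 + s ^ 2)⁻¹ := by
  unfold JJi
  rcases eq_or_ne s 0 with rfl | hs
  · simp; positivity
  have hs2 : 0 < s ^ 2 := by positivity
  rw [← div_eq_mul_inv, div_le_div_iff₀ hs2 (by positivity)]
  have h1 := gg_lip A hA (t + s) t
  rw [add_sub_cancel_left] at h1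
  have h2 : (gg A (t + s) - gg A t) ^ 2 ≤ A ^ 2 * s ^ 2 := by
    rw [← mul_pow]; apply sq_le_sq.2; rwa [abs_mul, abs_of_pos hA]
  have h3 : (gg A (t + s) - gg A t) ^ 2 ≤ 4 := by
    have a := abs_le.1 (th_abs (A * Real.sin (t + s)))
    have b := abs_le.1 (th_abs (A * Real.sin t))
    have : |gg A (t + s) - gg A t| ≤ 2 := by
      unfold gg; rw [abs_le]; constructor <;> linarith
    have := sq_le_sq' (by linarith [(abs_le.1 this).1]) (abs_le.1 this).2
    linarith
  nlinarith

lemma JJi_meas (A : ℝ) : Measurable (Function.uncurry (JJi A)) := by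
  unfold JJi Function.uncurry
  have := (gg_cont A).measurable
  fun_prop

lemma JJi_meas' (A t : ℝ) : Measurable (JJi A t) := by
  unfold JJi
  have := (gg_cont A).measurable
  fun_prop

lemma JJi_int (A : ℝ) (hA : 0 < A) (t : ℝ) : Integrable (JJi A t) := by
  refine (integrable_inv_one_add_sq.const_mul (A ^ 2 + 4)).mono' (JJi_meas' A t).aestronglyMeasurable
    (Eventually.of_forall fun s => ?_)
  rw [Real.norm_eq_abs, abs_of_nonneg (JJi_nonneg _ _ _)]
  exact JJi_le A hA t s

lemma JJ_nonneg (A t : ℝ) : 0 ≤ JJ A t := integral_nonneg (JJi_nonneg A t)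

lemma JJ_meas (A : ℝ) : Measurable (JJ A) := by
  have := (JJi_meas A).stronglyMeasurable.integral_prod_right (ν := volume)
  exact this.measurable

lemma JJ_le (A : ℝ) (hA : 0 < A) (t : ℝ) : JJ A t ≤ (A ^ 2 + 4) * π := by
  rw [← integral_univ_inv_one_add_sq, ← integral_const_mul]
  exact integral_mono (JJi_int A hA t) (integrable_inv_one_add_sq.const_mul _) (JJi_le A hA t)

lemma JJ_ii (A : ℝ) (hA : 0 < A) (a b : ℝ) : IntervalIntegrable (JJ A) volume a b := by
  refine (intervalIntegrable_const (c := (A ^ 2 + 4) * π)).mono_fun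
    (JJ_meas A).aestronglyMeasurable (Eventually.of_forall fun t => ?_)
  show ‖JJ A t‖ ≤ |(A ^ 2 + 4) * π|
  rw [Real.norm_eq_abs, abs_of_nonneg (JJ_nonneg _ _)]
  exact (JJ_le A hA t).trans (le_abs_self _)

lemma JJ_periodic (A : ℝ) : Function.Periodic (JJ A) π := by
  intro t
  unfold JJ
  congr 1; ext s
  unfold JJi
  rw [show t + π + s = t + s + π by ring, gg_pi, gg_pi]
  ring

lemma JJ_even (A t : ℝ) : JJ A (-t) = JJ A t := by
  unfold JJ
  rw [← integral_neg_eq_self]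
  congr 1; ext s
  unfold JJi
  rw [← neg_add, gg_neg, gg_neg]
  ring

lemma JJ_lower (A : ℝ) (hA : 0 < A) (τ : ℝ) (h0 : 0 < τ) (h1 : τ ≤ π / 2) :
    4 / τ - 8 / π - 4 * π / (A * τ ^ 2) ≤ JJ A (-τ) := by
  have hpi := Real.pi_pos
  set k := 4 * A / π with hk
  have hk0 : 0 < k := by positivity
  set E := Real.exp (-(k * τ)) with hE
  have hEb : E ≤ 1 / (k * τ) := by
    rw [hE, Real.exp_neg, ← one_div]
    apply one_div_le_one_div_of_le (by positivity)
    linarith [Real.add_one_le_exp (k * τ)]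
  have hE0 : 0 < E := Real.exp_pos _
  -- the comparison function
  let q : ℝ → ℝ := fun s => (4 - 8 * E) / s ^ 2 - 8 * Real.exp (-(k * (s - τ))) / τ ^ 2
  let Q : ℝ → ℝ := fun s => -(4 - 8 * E) / s + 8 / k * Real.exp (-(k * (s - τ))) / τ ^ 2
  have hQ : ∀ s ∈ Set.uIcc τ (τ + π / 2), HasDerivAt Q (q s) s := by
    intro s hs
    rw [Set.uIcc_of_le (by linarith)] at hs
    have hs0 : s ≠ 0 := by have := hs.1; linarith
    have a := (hasDerivAt_inv hs0).const_mul (-(4 - 8 * E))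
    have b := ((((hasDerivAt_id s).sub_const τ).const_mul k).neg.exp).const_mul (8 / k)
    have c := a.add (b.div_const (τ ^ 2))
    refine (c.congr_deriv ?_).congr_of_eventuallyEq (Eventually.of_forall fun x => ?_)
    · simp only [q, id, Pi.neg_apply]
      field_simp
      ring
    · simp only [Q, id, Pi.add_apply, Pi.neg_apply, div_eq_mul_inv]
  have hqc : ContinuousOn q (Set.uIcc τ (τ + π / 2)) := by
    rw [Set.uIcc_of_le (by linarith)]
    have : ∀ s ∈ Set.Icc τ (τ + π / 2), s ^ 2 ≠ 0 := fun s hs => by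
      have := hs.1
      have : 0 < s := by linarith
      positivity
    have h2 : ∀ s ∈ Set.Icc τ (τ + π / 2), τ ^ 2 ≠ 0 := fun s hs => by positivity
    fun_prop (disch := assumption)
  have hqi := hqc.intervalIntegrable (μ := volume)
  have hint : ∫ s in τ..(τ + π / 2), q s = Q (τ + π / 2) - Q τ :=
    intervalIntegral.integral_eq_sub_of_hasDerivAt hQ hqi
  have hJ : ∫ s in τ..(τ + π / 2), q s ≤ JJ A (-τ) := by
    have : ∫ s in τ..(τ + π / 2), JJi A (-τ) s ≤ JJ A (-τ) := by
      rw [intervalIntegral.integral_of_le (by linarith)]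
      exact setIntegral_le_integral (JJi_int A hA _) (Eventually.of_forall (JJi_nonneg A _))
    refine le_trans ?_ this
    apply intervalIntegral.integral_mono_on (by linarith) hqi ((JJi_int A hA _).intervalIntegrable)
    intro s hs
    have hs0 : 0 < s := lt_of_lt_of_le h0 hs.1
    have ha := gg_lower A hA (s - τ) (by linarith [hs.1]) (by linarith [hs.2])
    have hb := gg_lower A hA τ h0.le h1
    have ha1 : gg A (s - τ) ≤ 1 := th_le_one _
    have hb1 : gg A τ ≤ 1 := th_le_one _
    rw [← hk] at ha hb
    rw [← hE] at hb
    simp only [q, JJi]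
    rw [gg_neg, show -τ + s = s - τ by ring]
    have e0 := Real.exp_pos (-(k * (s - τ)))
    have e1 : 8 * Real.exp (-(k * (s - τ))) / s ^ 2 ≤ 8 * Real.exp (-(k * (s - τ))) / τ ^ 2 := by
      gcongr
      exact hs.1
    have e2 : (4 - 8 * E - 8 * Real.exp (-(k * (s - τ)))) / s ^ 2
        ≤ (gg A (s - τ) - -gg A τ) ^ 2 / s ^ 2 := by
      gcongr
      nlinarith [sq_nonneg (2 - gg A (s - τ) - gg A τ)]
    have e3 : (4 - 8 * E - 8 * Real.exp (-(k * (s - τ)))) / s ^ 2 = (4 - 8 * E) / s ^ 2 -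
      8 * Real.exp (-(k * (s - τ))) / s ^ 2 := by ring
    linarith
  refine le_trans ?_ hJ
  rw [hint]
  have hQ1 : -(4 / (π / 2)) ≤ Q (τ + π / 2) := by
    simp only [Q]
    have e1 : -(4 / (π / 2)) ≤ -(4 - 8 * E) / (τ + π / 2) := by
      have : -(4 - 8 * E) / (τ + π / 2) = - (4 / (τ + π / 2)) + 8 * E / (τ + π / 2) := by ring
      rw [this]
      have : 4 / (τ + π / 2) ≤ 4 / (π / 2) := by gcongr; linarith
      have : 0 ≤ 8 * E / (τ + π / 2) := by positivity
      linarith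
    have : 0 ≤ 8 / k * Real.exp (-(k * (τ + π / 2 - τ))) / τ ^ 2 := by positivity
    linarith
  have hQ2 : Q τ = - (4 / τ) + 8 * E / τ + 8 / k / τ ^ 2 := by
    simp only [Q]
    simp
    ring
  have hE2 : 8 * E / τ ≤ 8 / k / τ ^ 2 := by
    calc 8 * E / τ ≤ 8 * (1 / (k * τ)) / τ := by gcongr
      _ = _ := by field_simp
  have hkk : 8 / k / τ ^ 2 = 2 * π / (A * τ ^ 2) := by
    rw [hk]; field_simp; ring
  have : 4 / (π / 2) = 8 / π := by field_simp; ring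
  have : 4 * π / (A * τ ^ 2) = 2 * (2 * π / (A * τ ^ 2)) := by ring
  linarith

lemma JJ_int_lower (A : ℝ) (hA : 1 ≤ A) :
    8 * (Real.log A - (1 + π)) ≤ ∫ t in (-(π / 2))..(π / 2), JJ A t := by
  have hpi := Real.pi_pos
  have hpi3 := Real.pi_gt_three
  have hA0 : 0 < A := by linarith
  have hAi : A⁻¹ ≤ 1 := inv_le_one_of_one_le₀ hA
  have hAp : 0 < A⁻¹ := by positivity
  have h1 : ∫ t in (-(π / 2))..(π / 2), JJ A t = 2 * ∫ t in (0:ℝ)..(π / 2), JJ A t := by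
    rw [← intervalIntegral.integral_add_adjacent_intervals (JJ_ii A hA0 (-(π / 2)) 0) (JJ_ii A hA0 0 _)]
    have : ∫ t in (-(π / 2))..0, JJ A t = ∫ t in (0:ℝ)..(π / 2), JJ A t := by
      have := intervalIntegral.integral_comp_neg (JJ A) (a := 0) (b := π / 2)
      simp only [JJ_even, neg_zero] at this
      exact this.symm
    rw [this]; ring
  have h2 : ∫ t in A⁻¹..(π / 2), JJ A t ≤ ∫ t in (0:ℝ)..(π / 2), JJ A t := by
    rw [← intervalIntegral.integral_add_adjacent_intervals (JJ_ii A hA0 0 A⁻¹) (JJ_ii A hA0 A⁻¹ _)]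
    have := intervalIntegral.integral_nonneg (μ := volume) hAp.le (fun u _ => JJ_nonneg A u)
    linarith
  let q : ℝ → ℝ := fun τ => 4 / τ - 8 / π - 4 * π / (A * τ ^ 2)
  let Q : ℝ → ℝ := fun τ => 4 * Real.log τ - 8 / π * τ + 4 * π / A * τ⁻¹
  have hle : A⁻¹ ≤ π / 2 := by linarith
  have hpos : ∀ s ∈ Set.uIcc A⁻¹ (π / 2), 0 < s := by
    intro s hs
    rw [Set.uIcc_of_le hle] at hs
    exact lt_of_lt_of_le hAp hs.1
  have hQ : ∀ s ∈ Set.uIcc A⁻¹ (π / 2), HasDerivAt Q (q s) s := by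
    intro s hs
    have hs0 : s ≠ 0 := (hpos s hs).ne'
    have a := (Real.hasDerivAt_log hs0).const_mul 4
    have b := (hasDerivAt_id s).const_mul (8 / π)
    have c := (hasDerivAt_inv hs0).const_mul (4 * π / A)
    refine (((a.sub b).add c).congr_deriv ?_)
    simp only [q]
    field_simp
    ring
  have hqc : ContinuousOn q (Set.uIcc A⁻¹ (π / 2)) := by
    have h1 : ∀ s ∈ Set.uIcc A⁻¹ (π / 2), s ≠ 0 := fun s hs => (hpos s hs).ne'
    have h2 : ∀ s ∈ Set.uIcc A⁻¹ (π / 2), A * s ^ 2 ≠ 0 := fun s hs => by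
      have := hpos s hs
      positivity
    fun_prop (disch := assumption)
  have hqi := hqc.intervalIntegrable (μ := volume)
  have hint : ∫ s in A⁻¹..(π / 2), q s = Q (π / 2) - Q A⁻¹ :=
    intervalIntegral.integral_eq_sub_of_hasDerivAt hQ hqi
  have h3 : ∫ s in A⁻¹..(π / 2), q s ≤ ∫ t in A⁻¹..(π / 2), JJ A t := by
    apply intervalIntegral.integral_mono_on hle hqi (JJ_ii A hA0 _ _)
    intro s hs
    rw [← JJ_even]
    exact JJ_lower A hA0 s (lt_of_lt_of_le hAp hs.1) hs.2
  have h4 : 4 * Real.log A - 4 - 4 * π ≤ Q (π / 2) - Q A⁻¹ := by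
    simp only [Q]
    have e1 : 0 ≤ Real.log (π / 2) := Real.log_nonneg (by linarith)
    have e2 : 8 / π * (π / 2) = 4 := by field_simp; ring
    have e3 : 4 * π / A * A⁻¹⁻¹ = 4 * π := by field_simp
    have e4 : 0 ≤ 4 * π / A * (π / 2)⁻¹ := by positivity
    have e5 : 0 ≤ 8 / π * A⁻¹ := by positivity
    rw [Real.log_inv, e2, e3]
    linarith
  rw [h1]
  linarith
lemma integral_cube (F : ℝ → ℝ) (hF : Measurable F) :
    ∫ x in cube, F (x 0) = ∫ t in (0:ℝ)..1, F t := by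
  have h1 : (volume : Measure R2).restrict cube
      = Measure.pi (fun _ : Fin 2 => (volume : Measure ℝ).restrict (Set.Ico (0:ℝ) 1)) := by
    rw [cube, volume_pi, Measure.restrict_pi_pi]
  have : IsProbabilityMeasure ((volume : Measure ℝ).restrict (Set.Ico (0:ℝ) 1)) :=
    ⟨by simp⟩
  have hmp := measurePreserving_eval
    (fun _ : Fin 2 => (volume : Measure ℝ).restrict (Set.Ico (0:ℝ) 1)) 0
  have h2 := integral_map (μ := Measure.pi
    (fun _ : Fin 2 => (volume : Measure ℝ).restrict (Set.Ico (0:ℝ) 1))) hmp.measurable.aemeasurable (f := F) hF.aestronglyMeasurable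
  rw [hmp.map_eq] at h2
  rw [h1, intervalIntegral.integral_of_le zero_le_one, ← integral_Ico_eq_integral_Ioc, h2]

lemma kernel_int (h : ℝ) (hh : h ≠ 0) :
    ∫⁻ y : ℝ, ENNReal.ofReal (1 / Real.sqrt (h ^ 2 + y ^ 2) ^ 3) = ENNReal.ofReal (2 / h ^ 2) := by
  have hh2 : 0 < h ^ 2 := by positivity
  have hpos : ∀ y : ℝ, 0 < h ^ 2 + y ^ 2 := fun y => by positivity
  have hsp : ∀ y : ℝ, 0 < Real.sqrt (h ^ 2 + y ^ 2) := fun y => Real.sqrt_pos.2 (hpos y)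
  let f : ℝ → ℝ := fun y => y / (h ^ 2 * Real.sqrt (h ^ 2 + y ^ 2))
  have hd : ∀ y, HasDerivAt f (1 / Real.sqrt (h ^ 2 + y ^ 2) ^ 3) y := by
    intro y
    have a : HasDerivAt (fun y : ℝ => h ^ 2 + y ^ 2) (2 * y) y := by
      simpa using ((hasDerivAt_pow 2 y).const_add (h ^ 2))
    have b := (a.sqrt (hpos y).ne').const_mul (h ^ 2)
    have c := (hasDerivAt_id y).div b (by have := hsp y; positivity)
    refine c.congr_deriv ?_
    have h3 := hsp y
    have h4 := Real.sq_sqrt (hpos y).le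
    set r := Real.sqrt (h ^ 2 + y ^ 2)
    simp only [id]
    field_simp
    rw [h4]; ring
  have htop : Tendsto f atTop (nhds (1 / h ^ 2)) := by
    have h1 : Tendsto (fun y : ℝ => 1 / (h ^ 2 * Real.sqrt (h ^ 2 * (y⁻¹) ^ 2 + 1))) atTop
        (nhds (1 / (h ^ 2 * Real.sqrt (h ^ 2 * 0 ^ 2 + 1)))) := by
      have : Tendsto (fun y : ℝ => h ^ 2 * Real.sqrt (h ^ 2 * (y⁻¹) ^ 2 + 1)) atTop
        (nhds (h ^ 2 * Real.sqrt (h ^ 2 * 0 ^ 2 + 1))) :=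
        ((((tendsto_inv_atTop_zero.pow 2).const_mul (h ^ 2)).add_const 1).sqrt).const_mul _
      exact tendsto_const_nhds.div this (by simp [hh])
    simp only [ne_eq, OfNat.ofNat_ne_zero, not_false_eq_true, zero_pow, mul_zero, zero_add,
      Real.sqrt_one, mul_one] at h1
    refine h1.congr' ?_
    filter_upwards [eventually_gt_atTop 0] with y hy
    simp only [f]
    have : h ^ 2 + y ^ 2 = y ^ 2 * (h ^ 2 * (y⁻¹) ^ 2 + 1) := by field_simp
    rw [this, Real.sqrt_mul (by positivity), Real.sqrt_sq hy.le]
    field_simp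
  have hodd : ∀ y, f (-y) = - f y := by
    intro y; simp only [f, neg_sq, neg_div]
  have hbot : Tendsto f atBot (nhds (-(1 / h ^ 2))) := by
    have := (htop.comp tendsto_neg_atBot_atTop).neg
    refine this.congr fun y => ?_
    simp [hodd]
  have hc : Continuous (fun y : ℝ => 1 / Real.sqrt (h ^ 2 + y ^ 2) ^ 3) := by
    have : ∀ y : ℝ, Real.sqrt (h ^ 2 + y ^ 2) ^ 3 ≠ 0 := fun y => by have := hsp y; positivity
    fun_prop (disch := assumption)
  have hi : Integrable (fun y : ℝ => 1 / Real.sqrt (h ^ 2 + y ^ 2) ^ 3) := by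
    let c := |h| * min 1 (h ^ 2)
    have hc0 : 0 < c := by
      have := abs_pos.2 hh
      have : 0 < min 1 (h ^ 2) := lt_min one_pos hh2
      positivity
    refine (integrable_inv_one_add_sq.const_mul c⁻¹).mono' hc.aestronglyMeasurable
      (Eventually.of_forall fun y => ?_)
    have h3 := hsp y
    rw [Real.norm_eq_abs, abs_of_nonneg (by positivity), ← mul_inv, one_div]
    apply inv_anti₀ (by positivity)
    have e1 : |h| ≤ Real.sqrt (h ^ 2 + y ^ 2) := Real.abs_le_sqrt (by nlinarith)
    have e2 : min 1 (h ^ 2) * (1 + y ^ 2) ≤ Real.sqrt (h ^ 2 + y ^ 2) ^ 2 := by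
      rw [Real.sq_sqrt (hpos y).le]
      have := min_le_left 1 (h ^ 2)
      have := min_le_right 1 (h ^ 2)
      nlinarith [sq_nonneg y]
    calc c * (1 + y ^ 2) = |h| * (min 1 (h ^ 2) * (1 + y ^ 2)) := by simp only [c]; ring
      _ ≤ Real.sqrt (h ^ 2 + y ^ 2) * Real.sqrt (h ^ 2 + y ^ 2) ^ 2 := by
        apply mul_le_mul e1 e2 _ h3.le
        have : 0 < min 1 (h ^ 2) := lt_min one_pos hh2
        positivity
      _ = _ := by ring
  rw [← ofReal_integral_eq_lintegral_ofReal hi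
    (Eventually.of_forall fun y => by have := hsp y; positivity),
    integral_of_hasDerivAt_of_tendsto hd hi hbot htop]
  congr 1; ring

lemma inner_int (q : ℝ → ℝ) (hq : Measurable q) (hq0 : ∀ s, 0 ≤ q s) :
    ∫ z : R2, q (z 0) / en2 z ^ 3 = 2 * ∫ s : ℝ, q s / s ^ 2 := by
  rw [← integral_const_mul]
  have hen : Measurable en2 := by unfold en2; fun_prop
  rw [integral_eq_lintegral_of_nonneg_ae
    (Eventually.of_forall fun z => by
      have := hq0 (z 0)
      have : 0 ≤ en2 z := Real.sqrt_nonneg _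
      simp only [Pi.zero_apply]; positivity)
    (by
      have : Measurable (fun z : R2 => q (z 0) / en2 z ^ 3) := by fun_prop
      exact this.aestronglyMeasurable),
    integral_eq_lintegral_of_nonneg_ae
    (Eventually.of_forall fun z => by
      have := hq0 z
      simp only [Pi.zero_apply]; positivity)
    (by
      have : Measurable (fun s : ℝ => 2 * (q s / s ^ 2)) := by fun_prop
      exact this.aestronglyMeasurable)]
  congr 1
  have hmp := (volume_preserving_finTwoArrow ℝ).symm
  rw [← hmp.lintegral_comp_emb (MeasurableEquiv.measurableEmbedding _)]
  have : ∀ p : ℝ × ℝ, ENNReal.ofReal (q ((MeasurableEquiv.finTwoArrow.symm p : R2) 0) /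
      en2 (MeasurableEquiv.finTwoArrow.symm p) ^ 3)
      = ENNReal.ofReal (q p.1) * ENNReal.ofReal (1 / Real.sqrt (p.1 ^ 2 + p.2 ^ 2) ^ 3) := by
    intro p
    rw [← ENNReal.ofReal_mul (hq0 _)]
    congr 1
    simp [en2, MeasurableEquiv.finTwoArrow, div_eq_mul_inv]
  simp_rw [this]
  rw [Measure.volume_eq_prod, lintegral_prod _ (by fun_prop)]
  have hae : ∀ᵐ s : ℝ, s ≠ 0 := by
    simp [ae_iff]
  apply lintegral_congr_ae
  filter_upwards [hae] with s hs
  rw [lintegral_const_mul _ (by fun_prop), kernel_int s hs, ← ENNReal.ofReal_mul (hq0 _)]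
  congr 1; ring

lemma periodic_int (F : ℝ → ℝ) (hF : Function.Periodic F π)
    (hi : ∀ a b, IntervalIntegrable F volume a b) (N : ℕ) (hN : 0 < N) :
    ∫ x in (0:ℝ)..1, (2 * π * N) * F (2 * π * N * x)
      = 2 * N * ∫ t in (-(π / 2))..(π / 2), F t := by
  have hpi := Real.pi_pos
  have hN' : (0:ℝ) < N := by exact_mod_cast hN
  have hne : 2 * π * N ≠ 0 := by positivity
  rw [intervalIntegral.integral_const_mul, intervalIntegral.integral_comp_mul_left _ hne, smul_eq_mul,
    mul_inv_cancel_left₀ hne]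
  have := hF.intervalIntegral_add_zsmul_eq (2 * N : ℤ) 0 hi
  have h2 := hF.intervalIntegral_add_eq 0 (-(π / 2))
  rw [h2] at this
  simp only [zero_add, zsmul_eq_mul] at this
  push_cast at this
  rw [mul_zero, mul_one, show 2 * π * N = 2 * N * π by ring, this,
    show -(π / 2) + π = π / 2 by ring]

lemma H12_eq (A : ℝ) (hA : 0 < A) (N : ℕ) (hN : 0 < N) :
    H12 (fun x => gg A (2 * π * N * x 0))
      = N / π * ∫ t in (-(π / 2))..(π / 2), JJ A t := by
  have hpi := Real.pi_pos
  have hN' : (0:ℝ) < N := by exact_mod_cast hN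
  have hw : 0 < 2 * π * N := by positivity
  unfold H12
  have hin : ∀ x : R2, ∫ z : R2, (gg A (2 * π * N * (x + z) 0) - gg A (2 * π * N * x 0)) ^ 2 / en2 z ^ 3
      = 2 * ((2 * π * N) * JJ A (2 * π * N * x 0)) := by
    intro x
    have hm := (gg_cont A).measurable
    have := inner_int (fun s => (gg A (2 * π * N * (x 0 + s)) - gg A (2 * π * N * x 0)) ^ 2)
      (by fun_prop) (fun s => sq_nonneg _)
    simp only [Pi.add_apply]
    rw [this]
    congr 1
    have h2 := Measure.integral_comp_mul_left (JJi A (2 * π * N * x 0)) (2 * π * N)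
    rw [abs_of_pos (by positivity), smul_eq_mul] at h2
    unfold JJ
    have h3 : ∫ s, JJi A (2 * π * N * x 0) s
      = (2 * π * N) * ∫ s, JJi A (2 * π * N * x 0) (2 * π * N * s) := by
      rw [h2, mul_inv_cancel_left₀ hw.ne']
    rw [h3, ← integral_const_mul, ← integral_const_mul]
    congr 1; ext s
    unfold JJi
    rw [← mul_add]
    rcases eq_or_ne s 0 with rfl | hs
    · simp
    field_simp
  simp_rw [hin]
  rw [integral_const_mul, integral_cube (fun s => (2 * π * N) * JJ A (2 * π * N * s))
    (by have := JJ_meas A; fun_prop), periodic_int _ (JJ_periodic A) (JJ_ii A hA) N hN]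
  field_simp
  ring

/-- the magnetization -/
def mm (A w : ℝ) (x : R2) : R3 :=
  ![1 / Real.cosh (A * Real.sin (w * x 0)), 0, th (A * Real.sin (w * x 0))]

lemma mm_mag (A : ℝ) (N : ℕ) : Mag (mm A (2 * π * N)) := by
  refine ⟨?_, ?_, ?_⟩
  · rw [contDiff_pi]
    have hphi : ContDiff ℝ 1 (fun x : R2 => A * Real.sin (2 * π * N * x 0)) := by fun_prop
    intro i
    fin_cases i
    · simp only [mm]
      exact contDiff_const.div (Real.contDiff_cosh.comp hphi) (fun x => (Real.cosh_pos _).ne')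
    · simp only [mm]
      exact contDiff_const
    · simp only [mm]
      exact th_contDiff.comp hphi
  · intro x n
    have : Real.sin (2 * π * N * (x 0 + (n 0 : ℝ))) = Real.sin (2 * π * N * x 0) := by
      have := Real.sin_add_int_mul_two_pi (2 * π * N * x 0) (N * n 0)
      rw [← this]; push_cast; ring_nf
    simp only [mm, Pi.add_apply, this]
  · intro x
    simp only [mm, Fin.sum_univ_three]
    have := th_sq (A * Real.sin (2 * π * N * x 0))
    simp
    simp at this
    linarith

lemma mm_grad (A w : ℝ) (x : R2) : gradVSq (mm A w) x
    = (A * w * Real.cos (w * x 0)) ^ 2 / Real.cosh (A * Real.sin (w * x 0)) ^ 2 := by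
  set φ := A * Real.sin (w * x 0) with hφ
  set φ' := A * w * Real.cos (w * x 0) with hφ'
  have hd : HasDerivAt (fun s : ℝ => A * Real.sin (w * s)) φ' (x 0) := by
    have a : HasDerivAt (fun s : ℝ => w * s) w (x 0) := by
      simpa using (hasDerivAt_id (x 0)).const_mul w
    refine (a.sin.const_mul A).congr_deriv ?_
    rw [hφ']; ring
  have hc := Real.cosh_pos φ
  let M : ℝ → R3 := fun s => ![1 / Real.cosh (A * Real.sin (w * s)), 0, th (A * Real.sin (w * s))]
  let M' : R3 := ![- (Real.sinh φ * φ') / Real.cosh φ ^ 2, 0, 1 / Real.cosh φ ^ 2 * φ']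
  have hM : HasDerivAt M M' (x 0) := by
    rw [hasDerivAt_pi]
    intro i
    fin_cases i
    · have := (hd.cosh).inv hc.ne'
      simp only [M, M', one_div]
      exact this
    · simp only [M, M']
      exact hasDerivAt_const _ _
    · simp only [M, M']
      exact (th_deriv φ).comp (x 0) hd
  have hm : HasFDerivAt (mm A w) ((ContinuousLinearMap.toSpanSingleton ℝ M').comp
      (ContinuousLinearMap.proj (R := ℝ) (φ := fun _ : Fin 2 => ℝ) 0)) x := by
    have h1 : HasFDerivAt M (ContinuousLinearMap.toSpanSingleton ℝ M')
      ((ContinuousLinearMap.proj (R := ℝ) (φ := fun _ : Fin 2 => ℝ) 0) x) := hM.hasFDerivAt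
    exact h1.comp x (ContinuousLinearMap.proj (R := ℝ) (φ := fun _ : Fin 2 => ℝ) 0).hasFDerivAt
  unfold gradVSq
  rw [hm.fderiv]
  simp [Fin.sum_univ_two, Fin.sum_univ_three, M']
  have := Real.cosh_sq φ
  field_simp
  rw [this]
/-- comparison density for the local energy -/
def PP (A t : ℝ) : ℝ := A * |Real.cos t| / Real.cosh (A * Real.sin t) ^ 2 + 1 / (2 * A)

lemma PP_cont (A : ℝ) : Continuous (PP A) := by
  unfold PP
  have : ∀ t : ℝ, Real.cosh (A * Real.sin t) ^ 2 ≠ 0 := fun t => by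
    have := Real.cosh_pos (A * Real.sin t)
    positivity
  have h2 : Continuous (fun t : ℝ => Real.cosh (A * Real.sin t) ^ 2) :=
    (Real.continuous_cosh.comp (by fun_prop)).pow 2
  exact (Continuous.div (by fun_prop) h2 this).add continuous_const

lemma PP_periodic (A : ℝ) : Function.Periodic (PP A) π := by
  intro t
  simp [PP, Real.cos_add_pi, Real.sin_add_pi]

lemma PP_int (A : ℝ) (hA : 0 < A) : ∫ t in (-(π / 2))..(π / 2), PP A t ≤ 2 + π / (2 * A) := by
  have hpi := Real.pi_pos
  have hQ : ∀ t ∈ Set.uIcc (-(π / 2)) (π / 2),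
      HasDerivAt (fun t => gg A t + 1 / (2 * A) * t) (PP A t) t := by
    intro t ht
    rw [Set.uIcc_of_le (by linarith)] at ht
    have hc : 0 ≤ Real.cos t := Real.cos_nonneg_of_mem_Icc ht
    have a := (th_deriv (A * Real.sin t)).comp t ((Real.hasDerivAt_sin t).const_mul A)
    have b := (hasDerivAt_id t).const_mul (1 / (2 * A))
    refine (a.add b).congr_deriv ?_
    simp only [PP]
    rw [abs_of_nonneg hc]
    ring
  rw [intervalIntegral.integral_eq_sub_of_hasDerivAt hQ ((PP_cont A).intervalIntegrable _ _), gg_neg]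
  have : gg A (π / 2) ≤ 1 := th_le_one _
  have e : 1 / (2 * A) * (π / 2) - 1 / (2 * A) * -(π / 2) = π / (2 * A) := by ring
  linarith

lemma density_le (A : ℝ) (hA : 0 < A) (t : ℝ) :
    A / 2 * ((1 + Real.cos t ^ 2) / Real.cosh (A * Real.sin t) ^ 2) ≤ PP A t := by
  unfold PP
  have h1 := cosh_ge (A * Real.sin t)
  set C := Real.cosh (A * Real.sin t) ^ 2
  have hC : 0 < C := by nlinarith [sq_nonneg (A * Real.sin t)]
  have hsc := Real.sin_sq_add_cos_sq t
  set s := Real.sin t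
  have hab := sq_abs (Real.cos t)
  have hc0 := abs_nonneg (Real.cos t)
  rw [← hab] at hsc ⊢
  set c := |Real.cos t|
  have h2 : (1 - c) ^ 2 ≤ (s ^ 2) ^ 2 := by
    have : s ^ 2 = (1 - c) * (1 + c) := by linarith
    rw [this, mul_pow]
    have : 1 ≤ (1 + c) ^ 2 := by nlinarith
    nlinarith [sq_nonneg (1 - c)]
  have hs1 : s ^ 2 ≤ 1 := by nlinarith
  have h3 : A ^ 2 * (1 - c) ^ 2 ≤ C := by
    have : A ^ 2 * (1 - c) ^ 2 ≤ A ^ 2 * (s ^ 2) ^ 2 := by gcongr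
    have : A ^ 2 * (s ^ 2) ^ 2 ≤ A ^ 2 * s ^ 2 := by
      apply mul_le_mul_of_nonneg_left _ (sq_nonneg A)
      nlinarith [sq_nonneg s]
    nlinarith
  have h4 : A / 2 * ((1 - c) ^ 2 / C) ≤ 1 / (2 * A) := by
    rw [← mul_div_assoc, div_le_div_iff₀ hC (by positivity)]
    nlinarith
  have h5 : A / 2 * ((1 + c ^ 2) / C) = A * c / C + A / 2 * ((1 - c) ^ 2 / C) := by
    field_simp; ring
  linarith

lemma local_le (A ε : ℝ) (hA : 0 < A) (hε : 0 < ε) (N : ℕ) (hN : 0 < N)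
    (h : A * (2 * π * N) * ε = 1) :
    (∫ x in cube, (ε / 2 * gradVSq (mm A (2 * π * N)) x
      + (1 - (mm A (2 * π * N) x 2) ^ 2) / (2 * ε))) ≤ 4 * N + π * N / A := by
  have hpi := Real.pi_pos
  have hN' : (0:ℝ) < N := by exact_mod_cast hN
  set w := 2 * π * N with hw
  have hw0 : 0 < w := by positivity
  let D : ℝ → ℝ := fun t => A / 2 * ((1 + Real.cos t ^ 2) / Real.cosh (A * Real.sin t) ^ 2)
  have hDc : Continuous D := by
    have : ∀ t : ℝ, Real.cosh (A * Real.sin t) ^ 2 ≠ 0 := fun t => by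
      have := Real.cosh_pos (A * Real.sin t)
      positivity
    have h2 : Continuous (fun t : ℝ => Real.cosh (A * Real.sin t) ^ 2) :=
      (Real.continuous_cosh.comp (by fun_prop)).pow 2
    exact continuous_const.mul (Continuous.div (by fun_prop) h2 this)
  have hden : ∀ x : R2, ε / 2 * gradVSq (mm A w) x + (1 - (mm A w x 2) ^ 2) / (2 * ε)
      = w * D (w * x 0) := by
    intro x
    rw [mm_grad]
    have : mm A w x 2 = th (A * Real.sin (w * x 0)) := by simp [mm]
    rw [this, th_sq]
    have hc := Real.cosh_pos (A * Real.sin (w * x 0))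
    have hAw : A * w = 1 / ε := by field_simp; linarith
    simp only [D]
    rw [show w * (A / 2 * ((1 + Real.cos (w * x 0) ^ 2) / Real.cosh (A * Real.sin (w * x 0)) ^ 2))
      = (A * w) / 2 * ((1 + Real.cos (w * x 0) ^ 2) / Real.cosh (A * Real.sin (w * x 0)) ^ 2) by ring,
      hAw]
    field_simp
    ring
  simp_rw [hden]
  rw [integral_cube (fun s => w * D (w * s)) (by have := hDc.measurable; fun_prop)]
  have h1 : ∫ t in (0:ℝ)..1, w * D (w * t) ≤ ∫ t in (0:ℝ)..1, w * PP A (w * t) := by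
    have := PP_cont A
    apply intervalIntegral.integral_mono_on zero_le_one
    · exact Continuous.intervalIntegrable (by fun_prop) _ _
    · exact Continuous.intervalIntegrable (by fun_prop) _ _
    · intro t _
      exact mul_le_mul_of_nonneg_left (density_le A hA _) hw0.le
  refine h1.trans ?_
  rw [hw, periodic_int _ (PP_periodic A) (fun a b => (PP_cont A).intervalIntegrable a b) N hN]
  have h2 := PP_int A hA
  calc 2 * N * ∫ t in (-(π / 2))..(π / 2), PP A t ≤ 2 * N * (2 + π / (2 * A)) := by gcongr
    _ = _ := by field_simp; ring

lemma Fen_le (A ε lam : ℝ) (hA : 1 ≤ A) (hε : 0 < ε) (hl : 0 < lam) (N : ℕ) (hN : 0 < N)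
    (h : A * (2 * π * N) * ε = 1) :
    Fen ε lam (mm A (2 * π * N)) ≤ 4 * N + π * N / A
      - lam / |Real.log ε| * (8 * N / π * (Real.log A - (1 + π))) := by
  have hpi := Real.pi_pos
  have hN' : (0:ℝ) < N := by exact_mod_cast hN
  have hA0 : 0 < A := by linarith
  unfold Fen
  have h1 := local_le A ε hA0 hε N hN h
  have h2 : 8 * N / π * (Real.log A - (1 + π)) ≤ H12 (fun x => mm A (2 * π * N) x 2) := by
    have : (fun x => mm A (2 * π * N) x 2) = (fun x : R2 => gg A (2 * π * N * x 0)) := by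
      ext x; simp [mm, gg]
    rw [this, H12_eq A hA0 N hN]
    calc 8 * N / π * (Real.log A - (1 + π)) = N / π * (8 * (Real.log A - (1 + π))) := by ring
      _ ≤ _ := by gcongr; exact JJ_int_lower A hA
  have h3 : 0 ≤ lam / |Real.log ε| := by positivity
  have := mul_le_mul_of_nonneg_left h2 h3
  linarith

/-- Lemma `le:F-SUPERcrit-ub`, upper bound in the supercritical
regime: existence of configurations achieving the optimal negative energy scaling. -/
theorem stmt_15 :
    ∃ K c : ℝ, 0 < K ∧ K < 1 ∧ 0 < c ∧
      ∀ ε lam : ℝ, 0 < ε → π / 2 < lam → ε ^ ((lam - π / 2) / lam) < K →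
        ∃ m : R2 → R3, Mag m ∧
          Fen ε lam m ≤ -c * lam * ε ^ ((π / 2 - lam) / lam) / |Real.log ε| := by
  have hpi := Real.pi_pos
  have hpi3 := Real.pi_gt_three
  have hpi4 := Real.pi_lt_four
  set κ : ℝ := Real.exp (-(3 + π)) / (2 * π) with hκ
  have hκ0 : 0 < κ := by positivity
  have hexp1 : Real.exp (-(3 + π)) ≤ 1 / 4 := by
    rw [Real.exp_neg, ← one_div]
    apply one_div_le_one_div_of_le (by norm_num)
    linarith [Real.add_one_le_exp (3 + π)]
  have hκpi : 2 * π * κ = Real.exp (-(3 + π)) := by rw [hκ]; field_simp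
  have hκ1 : κ < 1 := by nlinarith
  refine ⟨κ, κ / 2, hκ0, hκ1, by positivity, ?_⟩
  intro ε lam hε hlam hK
  have hl0 : 0 < lam := by linarith
  have hs : 0 < (lam - π / 2) / lam := div_pos (by linarith) hl0
  have hε1 : ε < 1 := by
    by_contra hcon
    push Not at hcon
    have := Real.one_le_rpow hcon hs.le
    linarith
  have hlog : Real.log ε < 0 := Real.log_neg hε hε1
  set L := |Real.log ε| with hL
  have hLe : L = - Real.log ε := abs_of_neg hlog
  have hL0 : 0 < L := by linarith
  set μ := lam / L with hμ
  have hμ0 : 0 < μ := by positivity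
  set δ := ε ^ ((π / 2 - lam) / lam) with hδ
  have hδ0 : 0 < δ := Real.rpow_pos_of_pos hε _
  have hδinv : ε ^ ((lam - π / 2) / lam) = δ⁻¹ := by
    rw [hδ, ← Real.rpow_neg hε.le]; congr 1; ring
  rw [hδinv] at hK
  have hκδ : 1 < κ * δ := by
    rw [inv_lt_iff_one_lt_mul₀ hδ0] at hK
    linarith
  have hlogδ : Real.log δ = L - π / (2 * μ) := by
    rw [hδ, Real.log_rpow hε, hμ, hLe]
    have : lam ≠ 0 := hl0.ne'
    field_simp
    ring
  -- number of periods
  set N := ⌊κ * δ⌋₊ with hNdef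
  have hN : 0 < N := Nat.floor_pos.2 hκδ.le
  have hN1 : (1:ℝ) ≤ N := by exact_mod_cast hN
  have hNle : (N : ℝ) ≤ κ * δ := Nat.floor_le (by positivity)
  have hNge : κ * δ / 2 ≤ N := by
    have := Nat.lt_floor_add_one (κ * δ)
    rw [← hNdef] at this
    linarith
  have hN0 : (0:ℝ) < N := by linarith
  set A := 1 / (2 * π * N * ε) with hAdef
  have hA0 : 0 < A := by positivity
  have hAe : A * (2 * π * N) * ε = 1 := by rw [hAdef]; field_simp
  have hlogA : π / (2 * μ) + (3 + π) ≤ Real.log A := by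
    have h1 : Real.log (1 / (2 * π * (κ * δ) * ε)) ≤ Real.log A := by
      apply Real.log_le_log (by positivity)
      rw [hAdef]
      gcongr
    refine le_trans (le_of_eq ?_) h1
    rw [show 2 * π * (κ * δ) * ε = Real.exp (-(3 + π)) * δ * ε by rw [← hκpi]; ring,
      one_div, Real.log_inv, Real.log_mul (by positivity) hε.ne', Real.log_mul (by positivity) hδ0.ne',
      Real.log_exp, hlogδ, hLe]
    ring
  have hq : 0 < π / (2 * μ) := by positivity
  have hA1 : 1 ≤ A := by
    by_contra hcon
    push Not at hcon
    have := Real.log_neg hA0 hcon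
    linarith
  have hAinv : 1 / A ≤ μ := by
    -- `A ≥ 1 + log A ≥ π / (2 μ)`
    have h1 := Real.log_le_sub_one_of_pos hA0
    have h2 : π / (2 * μ) ≤ A := by linarith
    rw [div_le_iff₀ hA0]
    rw [div_le_iff₀ (by positivity)] at h2
    nlinarith
  refine ⟨mm A (2 * π * N), mm_mag A N, ?_⟩
  refine (Fen_le A ε lam hA1 hε hl0 N hN hAe).trans ?_
  rw [← hL, ← hμ]
  have hrhs : -(κ / 2) * lam * δ / L = - (κ * δ / 2 * μ) := by rw [hμ]; ring
  rw [hrhs]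
  have h1 : π * N / A ≤ π * N * μ := by
    calc π * N / A = π * N * (1 / A) := by ring
      _ ≤ _ := by gcongr
  have h2 : μ * (8 * N / π * (π / (2 * μ) + 2)) ≤ μ * (8 * N / π * (Real.log A - (1 + π))) := by
    gcongr; linarith
  have h3 : μ * (8 * N / π * (π / (2 * μ) + 2)) = 4 * N + 16 / π * (N * μ) := by
    field_simp; ring
  have h4 : κ * δ / 2 * μ ≤ N * μ := by gcongr
  have h5 : π + 1 ≤ 16 / π := by
    rw [le_div_iff₀ hpi]
    nlinarith [Real.pi_lt_d2]
  have h6 : (π + 1) * (N * μ) ≤ 16 / π * (N * μ) :=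
    mul_le_mul_of_nonneg_right h5 (by positivity)
  linarith
end
end
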